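/- arXiv:1710.05368 — 3 statements merged into one kernel-verified Lean document; each statement's English description precedes it below -/
import Mathlib

section
/- Let G be a bounded Petri game with one system player. Then G admits a winning, deadlock-avoiding strategy if and only if Player 0 has a winning strategy in the finite graph game Graph(G). -/
/-- A Petri net over places `P` and transitions `T`: each transition has a
nonempty finite multiset precondition and postcondition (encoding the flow
relation `F`), and there is a finite initial marking. -/
structure PetriNet (P T : Type) where
  pre  : T → Multiset P
  post : T → Multiset P
  init : Multiset P
  pre_ne  : ∀ t, pre t ≠ 0
  post_ne : ∀ t, post t ≠ 0

namespace PetriNet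

variable {P T : Type}

/-- A transition `t` is enabled in a marking `M` if `pre t ⊆ M`. -/
def Enabled (N : PetriNet P T) (M : Multiset P) (t : T) : Prop :=
  N.pre t ≤ M

/-- `M →t M'`: firing an enabled transition. -/
def Fires [DecidableEq P] (N : PetriNet P T) (M : Multiset P) (t : T) (M' : Multiset P) : Prop :=
  N.pre t ≤ M ∧ M' = M - N.pre t + N.post t

def Step [DecidableEq P] (N : PetriNet P T) (M M' : Multiset P) : Prop :=
  ∃ t, N.Fires M t M'

/-- A marking is reachable if obtained from the initial marking by firing a
finite sequence of transitions. -/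
def Reachable [DecidableEq P] (N : PetriNet P T) (M : Multiset P) : Prop :=
  Relation.ReflTransGen N.Step N.init M

/-- The flow relation on nodes (places ⊕ transitions). -/
def Flow (N : PetriNet P T) : P ⊕ T → P ⊕ T → Prop
  | Sum.inl p, Sum.inr t => p ∈ N.pre t
  | Sum.inr t, Sum.inl p => p ∈ N.post t
  | _, _ => False

/-- `<` : transitive closure of the flow relation. -/
def CLt (N : PetriNet P T) : P ⊕ T → P ⊕ T → Prop := Relation.TransGen N.Flow

/-- `≤` : reflexive-transitive closure of the flow relation. -/
def CLe (N : PetriNet P T) : P ⊕ T → P ⊕ T → Prop := Relation.ReflTransGen N.Flow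

/-- Nodes `x`, `y` are in conflict if from some place `q` (distinct from both)
one can reach `x` and `y` via two different outgoing transitions of `q`. -/
def Conflict (N : PetriNet P T) (x y : P ⊕ T) : Prop :=
  ∃ q : P, Sum.inl q ≠ x ∧ Sum.inl q ≠ y ∧
    ∃ t₁ t₂ : T, t₁ ≠ t₂ ∧ q ∈ N.pre t₁ ∧ q ∈ N.pre t₂ ∧
      N.CLe (Sum.inr t₁) x ∧ N.CLe (Sum.inr t₂) y

/-- Concurrent: neither causally related nor in conflict. -/
def Concurrent (N : PetriNet P T) (x y : P ⊕ T) : Prop :=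
  ¬ N.CLe x y ∧ ¬ N.CLe y x ∧ ¬ N.Conflict x y

/-- Occurrence net: pre/postconditions are sets, every place has at most one
incoming transition, the initial marking is the set of places without incoming
transitions, the inverse flow relation is well-founded, and no transition is in
self-conflict. -/
structure IsOccurrence (N : PetriNet P T) : Prop where
  pre_nodup : ∀ t, (N.pre t).Nodup
  post_nodup : ∀ t, (N.post t).Nodup
  unique_pre : ∀ p : P, ∀ t₁ t₂ : T, p ∈ N.post t₁ → p ∈ N.post t₂ → t₁ = t₂
  init_nodup : N.init.Nodup
  mem_init : ∀ p : P, p ∈ N.init ↔ ∀ t : T, p ∉ N.post t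
  wf : WellFounded N.Flow
  no_self_conflict : ∀ t : T, ¬ N.Conflict (Sum.inr t) (Sum.inr t)

def PairwiseConcurrent (N : PetriNet P T) (C : Set P) : Prop :=
  ∀ p ∈ C, ∀ q ∈ C, p ≠ q → N.Concurrent (Sum.inl p) (Sum.inl q)

/-- A cut: a maximal set of pairwise concurrent places. -/
def IsCut (N : PetriNet P T) (C : Set P) : Prop :=
  N.PairwiseConcurrent C ∧ ∀ D : Set P, N.PairwiseConcurrent D → C ⊆ D → D = C

end PetriNet

/-- `(N₁, fP, fT)` is an initial branching process of `N₂`: `N₁` is an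
occurrence net, `(fP, fT)` is an initial homomorphism, and transitions with the
same precondition and the same image coincide. -/
structure IsBranchingProcess {P₁ T₁ P₂ T₂ : Type}
    (N₁ : PetriNet P₁ T₁) (N₂ : PetriNet P₂ T₂)
    (fP : P₁ → P₂) (fT : T₁ → T₂) : Prop where
  occ : N₁.IsOccurrence
  map_pre : ∀ t, (N₁.pre t).map fP = N₂.pre (fT t)
  map_post : ∀ t, (N₁.post t).map fP = N₂.post (fT t)
  map_init : N₁.init.map fP = N₂.init
  trans_inj : ∀ t₁ t₂, N₁.pre t₁ = N₁.pre t₂ → fT t₁ = fT t₂ → t₁ = t₂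

/-- A Petri game: the places of the underlying net are partitioned into system
places (`isSystem`) and environment places, together with a set of bad
markings. -/
structure PetriGame (P T : Type) where
  net : PetriNet P T
  isSystem : P → Prop
  bad : Set (Multiset P)

namespace PetriGame

variable {P T : Type}

/-- A purely environmental transition: no system place in its precondition. -/
def PureEnv (G : PetriGame P T) (t : T) : Prop := ∀ p ∈ G.net.pre t, ¬ G.isSystem p

/-- A system transition: some system place in its precondition. -/
def SysTrans (G : PetriGame P T) (t : T) : Prop := ∃ p ∈ G.net.pre t, G.isSystem p

/-- The outgoing transitions of a place `s`. -/
def postOf (G : PetriGame P T) (s : P) : Set T := {t | s ∈ G.net.pre t}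

/-- `G` has one system player: every reachable marking contains exactly one
system place (one system token). -/
def OneSystemPlayer [DecidableEq P] (G : PetriGame P T) : Prop :=
  ∀ M, G.net.Reachable M → ∃ s : P, G.isSystem s ∧ M.count s = 1 ∧
    ∀ s' : P, G.isSystem s' → s' ∈ M → s' = s

/-- `G` is bounded: `k`-bounded for some `k ≥ 1`. -/
def Bounded [DecidableEq P] (G : PetriGame P T) : Prop :=
  ∃ k : ℕ, 1 ≤ k ∧ ∀ M, G.net.Reachable M → ∀ p : P, M.count p ≤ k

/-- A winning, deadlock-avoiding strategy for the Petri game `G`: an initial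
branching process `(N', fP, fT)` of the underlying net satisfying justified
refusal, safety, determinism and deadlock avoidance. -/
structure IsWinningStrategy [DecidableEq P] (G : PetriGame P T) {P' T' : Type}
    [DecidableEq P'] (N' : PetriNet P' T') (fP : P' → P) (fT : T' → T) : Prop where
  bp : IsBranchingProcess N' G.net fP fT
  justified_refusal : ∀ (S : Multiset P') (t' : T),
      S.Nodup →
      (∀ p ∈ S, ∀ q ∈ S, p ≠ q → N'.Concurrent (Sum.inl p) (Sum.inl q)) →
      S.map fP = G.net.pre t' →
      (¬ ∃ t : T', fT t = t' ∧ N'.pre t = S) →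
      ∃ s ∈ S, G.isSystem (fP s) ∧ ∀ t : T', s ∈ N'.pre t → fT t ≠ t'
  safety : ∀ M, N'.Reachable M → M.map fP ∉ G.bad
  determinism : ∀ s : P', G.isSystem (fP s) → ∀ M, N'.Reachable M → s ∈ M →
      ∀ t₁ t₂ : T', s ∈ N'.pre t₁ → s ∈ N'.pre t₂ →
        N'.Enabled M t₁ → N'.Enabled M t₂ → t₁ = t₂
  deadlock_avoidance : ∀ M, N'.Reachable M →
      (∃ t : T, G.net.Enabled (M.map fP) t) → ∃ t' : T', N'.Enabled M t'

/-- `G` admits a winning, deadlock-avoiding strategy. -/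
def HasWinningStrategy [DecidableEq P] (G : PetriGame P T) : Prop :=
  ∃ (P' T' : Type) (_ : DecidableEq P') (N' : PetriNet P' T')
    (fP : P' → P) (fT : T' → T), IsWinningStrategy G N' fP fT

end PetriGame

/-- Play prefixes (most recent vertex first) consistent with a Player-0
strategy `σ` in a graph game: starting at `init`, Player 0 moves to `σ`'s
choice at her vertices, and Player 1 may move along any edge at hers. -/
inductive ConsistentPlay {V : Type} (edge : V → V → Prop) (isP0 : V → Prop)
    (σ : List V → V) (init : V) : List V → Prop
  | base : ConsistentPlay edge isP0 σ init [init]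
  | stepP0 {h : List V} {v : V} :
      ConsistentPlay edge isP0 σ init (v :: h) → isP0 v → edge v (σ (v :: h)) →
      ConsistentPlay edge isP0 σ init (σ (v :: h) :: v :: h)
  | stepP1 {h : List V} {v w : V} :
      ConsistentPlay edge isP0 σ init (v :: h) → ¬ isP0 v → edge v w →
      ConsistentPlay edge isP0 σ init (w :: v :: h)

/-- Player 0 has a winning strategy in the graph game `(edge, isP0, bad, init)`:
a strategy that always proposes an actual successor at every Player-0 vertex it
reaches (each Player-0 node of the strategy tree has one child, labeled with a
successor) and such that no consistent play ever visits a bad vertex. -/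
def WinningP0 {V : Type} (edge : V → V → Prop) (isP0 : V → Prop)
    (bad : V → Prop) (init : V) : Prop :=
  ∃ σ : List V → V,
    (∀ (h : List V) (v : V), ConsistentPlay edge isP0 σ init (v :: h) → isP0 v →
        edge v (σ (v :: h))) ∧
    (∀ (l : List V) (v : V), ConsistentPlay edge isP0 σ init l → v ∈ l → ¬ bad v)

/-- Vertices of `Graph(G)`: a marking together with either `⊤` (`none`,
Player 0 to choose a commitment) or a commitment `c` (`some c`, Player 1). -/
abbrev GVertex (P T : Type) := Multiset P × Option (Set T)

/-- Edges of `Graph(G)`: (E1) Player 0 picks a commitment `c ⊆ post(s_M)`;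
(E2) Player 1 fires a purely environmental transition; (E3) Player 1 fires a
system transition from the commitment. -/
inductive GEdge {P T : Type} [DecidableEq P] (G : PetriGame P T) :
    GVertex P T → GVertex P T → Prop
  | e1 {M : Multiset P} {c : Set T} {s : P} :
      G.isSystem s → s ∈ M → c ⊆ G.postOf s →
      GEdge G (M, none) (M, some c)
  | e2 {M M' : Multiset P} {c : Set T} {t : T} :
      G.PureEnv t → G.net.Fires M t M' →
      GEdge G (M, some c) (M', some c)
  | e3 {M M' : Multiset P} {c : Set T} {t : T} :
      G.SysTrans t → t ∈ c → G.net.Fires M t M' →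
      GEdge G (M, some c) (M', none)

/-- Bad vertices of `Graph(G)`: (X1) bad marking, (X2a) two distinct committed
transitions enabled, (X2b) a committed enabled transition with
`0 < pre(t)(p) < M(p)` for some place `p`, (X3) deadlock: some transition of
the net is enabled but all enabled ones are system transitions outside the
commitment. -/
def GBad {P T : Type} [DecidableEq P] (G : PetriGame P T) : GVertex P T → Prop :=
  fun v => match v with
  | (_, none) => False
  | (M, some c) =>
      M ∈ G.bad ∨
      (∃ t₁ ∈ c, ∃ t₂ ∈ c, t₁ ≠ t₂ ∧ G.net.Enabled M t₁ ∧ G.net.Enabled M t₂) ∨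
      (∃ t ∈ c, G.net.Enabled M t ∧
        ∃ p : P, 0 < (G.net.pre t).count p ∧ (G.net.pre t).count p < M.count p) ∨
      ((∃ t : T, G.net.Enabled M t) ∧
        ∀ t : T, G.net.Enabled M t → G.SysTrans t ∧ t ∉ c)

/-- Player 0 has a winning strategy in `Graph(G)`. -/
def PetriGame.HasWinningGraphStrategy {P T : Type} [DecidableEq P]
    (G : PetriGame P T) : Prop :=
  WinningP0 (GEdge G) (fun v => v.2 = none) (GBad G) (G.net.init, none)

/-- Vertices of `Graph'(G)`: marking, commitment (or `⊤`), and responsibility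
multiset. -/
abbrev GVertex' (P T : Type) := Multiset P × Option (Set T) × Multiset P

/-- Edges of `Graph'(G)`: (E'1) Player 0 picks a commitment; (E'2) Player 1
fires a purely environmental transition `t`, updating the responsibility
multiset to `R - pre(t) + {o}` for a chosen `o ∈ post(t)`; (E'3) Player 1 fires
a committed system transition `t` with `R ⊆ pre(t)`, resetting the
responsibility multiset to the system place of the new marking. -/
inductive GEdge' {P T : Type} [DecidableEq P] (G : PetriGame P T) :
    GVertex' P T → GVertex' P T → Prop
  | e1 {M : Multiset P} {c : Set T} {s : P} :
      G.isSystem s → s ∈ M → c ⊆ G.postOf s →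
      GEdge' G (M, none, {s}) (M, some c, {s})
  | e2 {M M' : Multiset P} {c : Set T} {R : Multiset P} {t : T} {o : P} :
      G.PureEnv t → G.net.Fires M t M' → o ∈ G.net.post t →
      GEdge' G (M, some c, R) (M', some c, R - G.net.pre t + {o})
  | e3 {M M' : Multiset P} {c : Set T} {R : Multiset P} {t : T} {s' : P} :
      G.SysTrans t → t ∈ c → G.net.Fires M t M' → R ≤ G.net.pre t →
      G.isSystem s' → s' ∈ M' →
      GEdge' G (M, some c, R) (M', none, {s'})

/-- Bad vertices of `Graph'(G)`: `(M, c, R)` is bad iff `(M, c)` is bad in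
`Graph(G)`. -/
def GBad' {P T : Type} [DecidableEq P] (G : PetriGame P T) : GVertex' P T → Prop :=
  fun v => GBad G (v.1, v.2.1)

/-- Player 0 has a winning strategy in `Graph'(G)` (the initial vertex is
`(In, ⊤, {s_In})` where `s_In` is the system place of the initial marking). -/
def PetriGame.HasWinningGraphStrategy' {P T : Type} [DecidableEq P]
    (G : PetriGame P T) : Prop :=
  ∃ s₀ : P, G.isSystem s₀ ∧ s₀ ∈ G.net.init ∧
    WinningP0 (GEdge' G) (fun v => v.2.1 = none) (GBad' G)
      (G.net.init, none, ({s₀} : Multiset P))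

theorem winningP0_iff_exists_invariant {V : Type} {edge : V → V → Prop} {isP0 bad : V → Prop}
    {init : V} :
    WinningP0 edge isP0 bad init ↔
      ∃ W : V → Prop, W init ∧ (∀ v, W v → ¬ bad v) ∧
        (∀ v, W v → isP0 v → ∃ w, edge v w ∧ W w) ∧
        (∀ v w, W v → ¬ isP0 v → edge v w → W w) := by
  classical
  constructor
  · rintro ⟨σ, hσ, hbad⟩
    refine ⟨fun v => ∃ h, ConsistentPlay edge isP0 σ init (v :: h), ⟨[], .base⟩, ?_, ?_, ?_⟩
    · rintro v ⟨h, hv⟩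
      exact hbad _ v hv (by simp)
    · rintro v ⟨h, hv⟩ h0
      exact ⟨_, hσ h v hv h0, _, .stepP0 hv h0 (hσ h v hv h0)⟩
    · rintro v w ⟨h, hv⟩ h0 hw
      exact ⟨_, .stepP1 hv h0 hw⟩
  · rintro ⟨W, hinit, hbad, h0, h1⟩
    choose! g hg using h0
    let σ : List V → V := fun l => g (l.headD init)
    have key : ∀ l, ConsistentPlay edge isP0 σ init l → ∀ v ∈ l, W v := by
      intro l hl
      induction hl with
      | base => simpa using hinit
      | @stepP0 h v _ hv _ ih =>
        intro w hw
        rcases List.mem_cons.1 hw with rfl | hw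
        · exact (hg v (ih v (by simp)) hv).2
        · exact ih w hw
      | @stepP1 h v w _ hv he ih =>
        intro x hx
        rcases List.mem_cons.1 hx with rfl | hx
        · exact h1 v _ (ih v (by simp)) hv he
        · exact ih x hx
    exact ⟨σ, fun h v hc hv => (hg v (key _ hc v (by simp)) hv).1,
      fun l v hl hv => hbad v (key l hl v hv)⟩

theorem Multiset.exists_le_map_eq {α β : Type*} {f : α → β} {s : Multiset α} {m : Multiset β}
    (h : m ≤ s.map f) : ∃ u ≤ s, u.map f = m := by
  classical
  induction s using Multiset.induction_on generalizing m with
  | empty => exact ⟨0, le_rfl, by simpa using h.antisymm (Multiset.zero_le _) |>.symm⟩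
  | cons a s ih =>
    rw [Multiset.map_cons] at h
    by_cases ha : f a ∈ m
    · obtain ⟨u, hu, hm⟩ := ih (m := m.erase (f a)) (by
        simpa using Multiset.erase_le_erase (f a) h)
      exact ⟨a ::ₘ u, Multiset.cons_le_cons a hu, by
        rw [Multiset.map_cons, hm, Multiset.cons_erase ha]⟩
    · obtain ⟨u, hu, hm⟩ := ih ((Multiset.le_cons_of_notMem ha).1 h)
      exact ⟨u, hu.trans (Multiset.le_cons_self _ _), hm⟩

theorem Multiset.map_tsub_of_le {α β : Type*} [DecidableEq α] [DecidableEq β] (f : α → β)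
    {s t : Multiset α} (h : t ≤ s) : (s - t).map f = s.map f - t.map f := by
  conv_rhs => rw [← tsub_add_cancel_of_le h, Multiset.map_add, add_tsub_cancel_right]

namespace PetriNet

variable {P T : Type} {N : PetriNet P T}

theorem CLe.eq_or_exists_pre {x : P ⊕ T} {t : T} (h : N.CLe x (Sum.inr t)) :
    x = Sum.inr t ∨ ∃ p ∈ N.pre t, N.CLe x (Sum.inl p) := by
  rcases Relation.ReflTransGen.cases_tail h with h | ⟨y, hy, hf⟩
  · exact .inl h.symm
  · rcases y with p | u
    · exact .inr ⟨p, hf, hy⟩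
    · exact hf.elim

theorem CLe.eq_or_exists_post {x : P ⊕ T} {p : P} (h : N.CLe x (Sum.inl p)) :
    x = Sum.inl p ∨ ∃ t, p ∈ N.post t ∧ N.CLe x (Sum.inr t) := by
  rcases Relation.ReflTransGen.cases_tail h with h | ⟨y, hy, hf⟩
  · exact .inl h.symm
  · rcases y with q | u
    · exact hf.elim
    · exact .inr ⟨u, hf, hy⟩

theorem Conflict.symm {x y : P ⊕ T} (h : N.Conflict x y) : N.Conflict y x := by
  obtain ⟨q, hx, hy, t₁, t₂, hne, h₁, h₂, hc₁, hc₂⟩ := h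
  exact ⟨q, hy, hx, t₂, t₁, hne.symm, h₂, h₁, hc₂, hc₁⟩

theorem Concurrent.symm {x y : P ⊕ T} (h : N.Concurrent x y) : N.Concurrent y x :=
  ⟨h.2.1, h.1, fun hc => h.2.2 hc.symm⟩

theorem cLe_of_mem_pre {p : P} {t : T} (h : p ∈ N.pre t) : N.CLe (Sum.inl p) (Sum.inr t) :=
  Relation.ReflTransGen.single h

theorem cLe_of_mem_post {p : P} {t : T} (h : p ∈ N.post t) : N.CLe (Sum.inr t) (Sum.inl p) :=
  Relation.ReflTransGen.single h

theorem IsOccurrence.not_cLe_of_flow (hN : N.IsOccurrence) {x y : P ⊕ T} (h : N.Flow x y) :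
    ¬ N.CLe y x := fun hc =>
  hN.wf.transGen.irrefl.irrefl _ (Relation.TransGen.head' h hc)

theorem IsOccurrence.cLe_of_cLe_place (hN : N.IsOccurrence) {x : P ⊕ T} {p : P} {t : T}
    (hp : p ∈ N.post t) (h : N.CLe x (Sum.inl p)) : x = Sum.inl p ∨ N.CLe x (Sum.inr t) := by
  rcases h.eq_or_exists_post with h | ⟨u, hu, h⟩
  · exact .inl h
  · exact .inr (hN.unique_pre p u t hu hp ▸ h)

theorem IsOccurrence.concurrent_post (hN : N.IsOccurrence) {t : T} {p q : P}
    (hp : p ∈ N.post t) (hq : q ∈ N.post t) (hpq : p ≠ q) :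
    N.Concurrent (Sum.inl p) (Sum.inl q) := by
  refine ⟨fun h => ?_, fun h => ?_, ?_⟩
  · rcases hN.cLe_of_cLe_place hq h with h | h
    · exact hpq (Sum.inl.inj h)
    · exact hN.not_cLe_of_flow (x := Sum.inr t) (y := Sum.inl p) hp h
  · rcases hN.cLe_of_cLe_place hp h with h | h
    · exact hpq (Sum.inl.inj h).symm
    · exact hN.not_cLe_of_flow (x := Sum.inr t) (y := Sum.inl q) hq h
  · rintro ⟨r, -, -, t₁, t₂, hne, h₁, h₂, hc₁, hc₂⟩
    refine hN.no_self_conflict t ⟨r, by simp, by simp, t₁, t₂, hne, h₁, h₂, ?_, ?_⟩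
    · exact (hN.cLe_of_cLe_place hp hc₁).resolve_left (by simp)
    · exact (hN.cLe_of_cLe_place hq hc₂).resolve_left (by simp)

theorem IsOccurrence.concurrent_init (hN : N.IsOccurrence) {p q : P}
    (hp : p ∈ N.init) (hq : q ∈ N.init) (hpq : p ≠ q) :
    N.Concurrent (Sum.inl p) (Sum.inl q) := by
  rw [hN.mem_init] at hp hq
  refine ⟨fun h => ?_, fun h => ?_, ?_⟩
  · rcases h.eq_or_exists_post with h | ⟨u, hu, -⟩
    · exact hpq (Sum.inl.inj h)
    · exact hq u hu
  · rcases h.eq_or_exists_post with h | ⟨u, hu, -⟩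
    · exact hpq (Sum.inl.inj h).symm
    · exact hp u hu
  · rintro ⟨r, -, -, t₁, t₂, hne, h₁, h₂, hc₁, hc₂⟩
    rcases hc₁.eq_or_exists_post with h | ⟨u, hu, -⟩
    · simp at h
    · exact hp u hu

/-- Firing `t` next to a place `r` concurrent to its precondition yields places concurrent
to `r`. -/
theorem IsOccurrence.concurrent_of_fire (hN : N.IsOccurrence) {t : T} {p r : P}
    (hp : p ∈ N.post t) (hr : r ∉ N.pre t)
    (hc : ∀ q ∈ N.pre t, N.Concurrent (Sum.inl q) (Sum.inl r)) :
    p ≠ r ∧ N.Concurrent (Sum.inl p) (Sum.inl r) := by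
  have hpre : ∀ q ∈ N.pre t, N.CLe (Sum.inl q) (Sum.inl p) := fun q hq =>
    (cLe_of_mem_pre hq).trans (cLe_of_mem_post hp)
  obtain ⟨q₀, hq₀⟩ := Multiset.exists_mem_of_ne_zero (N.pre_ne t)
  have hnle : ¬ N.CLe (Sum.inl p) (Sum.inl r) := fun h => (hc q₀ hq₀).1 ((hpre q₀ hq₀).trans h)
  have hne : p ≠ r := by
    rintro rfl
    exact hnle .refl
  refine ⟨hne, hnle, fun h => ?_, ?_⟩
  · rcases hN.cLe_of_cLe_place hp h with h | h
    · exact hne (Sum.inl.inj h).symm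
    · rcases h.eq_or_exists_pre with h | ⟨q, hq, h⟩
      · simp at h
      · exact (hc q hq).2.1 h
  · rintro ⟨x, -, hxr, t₁, t₂, hne', h₁, h₂, hc₁, hc₂⟩
    rcases hN.cLe_of_cLe_place hp hc₁ with h | h
    · simp at h
    · rcases h.eq_or_exists_pre with h | ⟨q, hq, h⟩
      · cases h
        exact (hc x h₁).1 ((cLe_of_mem_pre h₂).trans hc₂)
      · refine (hc q hq).2.2 ⟨x, ?_, hxr, t₁, t₂, hne', h₁, h₂, h, hc₂⟩
        intro hxq
        exact hN.not_cLe_of_flow (x := Sum.inl x) (y := Sum.inr t₁) h₁ (hxq ▸ h)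

theorem IsOccurrence.nodup_and_concurrent_of_reachable [DecidableEq P] (hN : N.IsOccurrence)
    {M : Multiset P} (hM : N.Reachable M) :
    M.Nodup ∧ ∀ p ∈ M, ∀ q ∈ M, p ≠ q → N.Concurrent (Sum.inl p) (Sum.inl q) := by
  induction hM with
  | refl => exact ⟨hN.init_nodup, fun p hp q hq => hN.concurrent_init hp hq⟩
  | @tail M M' _ hs ih =>
    obtain ⟨t, hle, rfl⟩ := hs
    obtain ⟨hnd, hc⟩ := ih
    have hsub : ∀ r, r ∈ M - N.pre t ↔ r ∈ M ∧ r ∉ N.pre t := fun r =>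
      Multiset.mem_sub_of_nodup hnd
    have key : ∀ p ∈ N.post t, ∀ r ∈ M - N.pre t,
        p ≠ r ∧ N.Concurrent (Sum.inl p) (Sum.inl r) := by
      intro p hp r hr
      rw [hsub] at hr
      refine hN.concurrent_of_fire hp hr.2 fun q hq =>
        hc q (Multiset.mem_of_le hle hq) r hr.1 ?_
      rintro rfl
      exact hr.2 hq
    refine ⟨?_, ?_⟩
    · rw [Multiset.nodup_add]
      refine ⟨Multiset.nodup_of_le (Multiset.sub_le_self _ _) hnd, hN.post_nodup t, ?_⟩
      rw [Multiset.disjoint_left]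
      exact fun {r} hr hp => (key r hp r hr).1 rfl
    · intro p hp q hq hpq
      rcases Multiset.mem_add.1 hp with hp | hp <;> rcases Multiset.mem_add.1 hq with hq | hq
      · exact hc p ((hsub p).1 hp).1 q ((hsub q).1 hq).1 hpq
      · exact (key q hq p hp).2.symm
      · exact (key p hp q hq).2
      · exact hN.concurrent_post hp hq hpq

end PetriNet

theorem IsBranchingProcess.reachable_map {P₁ T₁ P₂ T₂ : Type} [DecidableEq P₁] [DecidableEq P₂]
    {N₁ : PetriNet P₁ T₁} {N₂ : PetriNet P₂ T₂} {fP : P₁ → P₂} {fT : T₁ → T₂}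
    (h : IsBranchingProcess N₁ N₂ fP fT) {M : Multiset P₁} (hM : N₁.Reachable M) :
    N₂.Reachable (M.map fP) := by
  induction hM with
  | refl => rw [h.map_init]; exact .refl
  | @tail M M' _ hs ih =>
    obtain ⟨t, hle, rfl⟩ := hs
    refine ih.tail ⟨fT t, h.map_pre t ▸ Multiset.map_le_map hle, ?_⟩
    rw [← h.map_pre, ← h.map_post, Multiset.map_add, Multiset.map_tsub_of_le fP hle]

theorem PetriGame.OneSystemPlayer.system_unique {P Q T : Type} [DecidableEq P]
    {G : PetriGame P T} (hone : G.OneSystemPlayer) {f : Q → P} {C : Multiset Q}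
    (hC : G.net.Reachable (C.map f)) {s s' : Q} (hs : s ∈ C) (hs' : s' ∈ C)
    (hss : G.isSystem (f s)) (hss' : G.isSystem (f s')) : s = s' := by
  obtain ⟨x, -, hx, hu⟩ := hone _ hC
  have h := hu _ hss (Multiset.mem_map_of_mem f hs)
  have h' := hu _ hss' (Multiset.mem_map_of_mem f hs')
  by_contra hne
  obtain ⟨D, rfl⟩ := Multiset.exists_cons_of_mem hs
  obtain ⟨D, rfl⟩ := Multiset.exists_cons_of_mem
    ((Multiset.mem_cons.1 hs').resolve_left (Ne.symm hne))
  simp [h, h'] at hx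

theorem PetriGame.OneSystemPlayer.exists_system {P Q T : Type} [DecidableEq P]
    {G : PetriGame P T} (hone : G.OneSystemPlayer) {f : Q → P} {C : Multiset Q}
    (hC : G.net.Reachable (C.map f)) : ∃ s ∈ C, G.isSystem (f s) := by
  obtain ⟨x, hx, hc, -⟩ := hone _ hC
  obtain ⟨s, hs, rfl⟩ := Multiset.mem_map.1 (Multiset.count_pos.1 (hc ▸ Nat.one_pos))
  exact ⟨s, hs, hx⟩

namespace PetriGame.IsWinningStrategy

variable {P T P' T' : Type} [DecidableEq P] [DecidableEq P'] {G : PetriGame P T}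
  {N' : PetriNet P' T'} {fP : P' → P} {fT : T' → T}

theorem exists_instance (hσ : IsWinningStrategy G N' fP fT)
    {C : Multiset P'} (hC : N'.Reachable C) {S : Multiset P'} (hS : S ≤ C) {t : T}
    (hSt : S.map fP = G.net.pre t)
    (hcom : ∀ s ∈ S, G.isSystem (fP s) → ∃ t', s ∈ N'.pre t' ∧ fT t' = t) :
    ∃ t', fT t' = t ∧ N'.pre t' = S := by
  obtain ⟨hnd, hc⟩ := hσ.bp.occ.nodup_and_concurrent_of_reachable hC
  by_contra hno
  obtain ⟨s, hs, hss, hst⟩ := hσ.justified_refusal S t (Multiset.nodup_of_le hS hnd)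
    (fun p hp q hq => hc p (Multiset.mem_of_le hS hp) q (Multiset.mem_of_le hS hq)) hSt hno
  obtain ⟨t', ht', rfl⟩ := hcom s hs hss
  exact hst t' ht' rfl

theorem hasWinningGraphStrategy (hone : G.OneSystemPlayer)
    (hσ : IsWinningStrategy G N' fP fT) : G.HasWinningGraphStrategy := by
  have hreach : ∀ {C}, N'.Reachable C → G.net.Reachable (C.map fP) := hσ.bp.reachable_map
  let com : P' → Set T := fun s => {t | ∃ t', s ∈ N'.pre t' ∧ fT t' = t}
  have hcom_sys : ∀ {s t}, G.isSystem (fP s) → t ∈ com s → fP s ∈ G.net.pre t := by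
    rintro s t hs ⟨t', ht', rfl⟩
    rw [← hσ.bp.map_pre]
    exact Multiset.mem_map_of_mem fP ht'
  -- A committed transition has an instance for each choice of places of the cut.
  have hinst : ∀ {C s t S}, N'.Reachable C → s ∈ C → G.isSystem (fP s) → t ∈ com s → S ≤ C →
      S.map fP = G.net.pre t → s ∈ S ∧ ∃ t', fT t' = t ∧ N'.pre t' = S := by
    intro C s t S hC hs hss ht hS hSt
    have huniq : ∀ s' ∈ S, G.isSystem (fP s') → s' = s := fun s' hs' hss' =>
      hone.system_unique (hreach hC) (Multiset.mem_of_le hS hs') hs hss' hss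
    refine ⟨?_, hσ.exists_instance hC hS hSt fun s' hs' hss' => huniq s' hs' hss' ▸ ht⟩
    obtain ⟨s', hs', he⟩ := Multiset.mem_map.1 (hSt ▸ hcom_sys hss ht)
    exact huniq s' hs' (he ▸ hss) ▸ hs'
  have hfire : ∀ {C S t M'}, N'.Reachable C → S ≤ C → G.net.Fires (C.map fP) t M' →
      (∃ t', fT t' = t ∧ N'.pre t' = S) → S.map fP = G.net.pre t → ∃ t', fT t' = t ∧
      N'.pre t' = S ∧ N'.Reachable (C - S + N'.post t') ∧ M' = (C - S + N'.post t').map fP := by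
    rintro C _ _ M' hC hS ⟨-, rfl⟩ ⟨t', rfl, rfl⟩ hSt
    refine ⟨t', rfl, rfl, Relation.ReflTransGen.tail hC ⟨t', hS, rfl⟩, ?_⟩
    rw [Multiset.map_add, hσ.bp.map_post, ← hSt, Multiset.map_tsub_of_le fP hS]
  refine winningP0_iff_exists_invariant.2 ⟨fun v => ∃ C, N'.Reachable C ∧ v.1 = C.map fP ∧
    ∀ c, v.2 = some c → ∃ s ∈ C, G.isSystem (fP s) ∧ c = com s, ?_, ?_, ?_, ?_⟩
  · exact ⟨N'.init, .refl, hσ.bp.map_init.symm, by simp⟩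
  · rintro ⟨M, _ | c⟩ ⟨C, hC, hM, hc⟩
    · simp [GBad]
    obtain ⟨s, hs, hss, rfl⟩ := hc _ rfl
    obtain rfl : M = C.map fP := hM
    rintro (hbad | ⟨t₁, ht₁, t₂, ht₂, hne, he₁, he₂⟩ | ⟨t, ht, he, p, hp, hpM⟩ | ⟨hen, hall⟩)
    · exact hσ.safety C hC hbad
    · obtain ⟨S₁, hS₁, hm₁⟩ := Multiset.exists_le_map_eq he₁
      obtain ⟨S₂, hS₂, hm₂⟩ := Multiset.exists_le_map_eq he₂
      obtain ⟨hs₁, u₁, rfl, rfl⟩ := hinst hC hs hss ht₁ hS₁ hm₁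
      obtain ⟨hs₂, u₂, rfl, rfl⟩ := hinst hC hs hss ht₂ hS₂ hm₂
      exact hne (congrArg fT (hσ.determinism s hss C hC hs u₁ u₂ hs₁ hs₂ hS₁ hS₂))
    · obtain ⟨S, hS, hm⟩ := Multiset.exists_le_map_eq he
      rw [← hm] at hp hpM
      obtain ⟨x, hx, rfl⟩ := Multiset.mem_map.1 (Multiset.count_pos.1 hp)
      have hCS : C = S + (C - S) := (add_tsub_cancel_of_le hS).symm
      obtain ⟨y, hy, hyx⟩ : ∃ y ∈ C - S, fP y = fP x := by
        rw [hCS, Multiset.map_add, Multiset.count_add] at hpM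
        exact Multiset.mem_map.1 (Multiset.count_pos.1 (by omega))
      have hnd := (hσ.bp.occ.nodup_and_concurrent_of_reachable hC).1
      have hyS : y ∉ S := ((Multiset.mem_sub_of_nodup hnd).1 hy).2
      have hS₂ : y ::ₘ S.erase x ≤ C := by
        conv_rhs => rw [hCS, add_comm]
        rw [← Multiset.singleton_add]
        exact add_le_add (Multiset.singleton_le.2 hy) (Multiset.erase_le _ _)
      have hm₂ : (y ::ₘ S.erase x).map fP = G.net.pre t := by
        rw [← hm, Multiset.map_cons, hyx, ← Multiset.map_cons, Multiset.cons_erase hx]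
      obtain ⟨hs₁, u₁, hu₁, rfl⟩ := hinst hC hs hss ht hS hm
      obtain ⟨hs₂, u₂, hu₂, he₂⟩ := hinst hC hs hss ht hS₂ hm₂
      have := hσ.determinism s hss C hC hs u₁ u₂ hs₁ (he₂ ▸ hs₂) hS (he₂.trans_le hS₂)
      apply hyS
      rw [this, he₂]
      exact Multiset.mem_cons_self _ _
    · obtain ⟨u, hu⟩ := hσ.deadlock_avoidance C hC hen
      obtain ⟨⟨p, hp, hps⟩, hnot⟩ :=
        hall (fT u) ((hσ.bp.map_pre u).symm.trans_le (Multiset.map_le_map hu))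
      rw [← hσ.bp.map_pre] at hp
      obtain ⟨s', hs', rfl⟩ := Multiset.mem_map.1 hp
      obtain rfl := hone.system_unique (hreach hC) (Multiset.mem_of_le hu hs') hs hps hss
      exact hnot ⟨u, hs', rfl⟩
  · rintro ⟨M, _⟩ ⟨C, hC, rfl : M = _, -⟩ (rfl : _ = none)
    obtain ⟨s, hs, hss⟩ := hone.exists_system (hreach hC)
    exact ⟨(_, some (com s)), .e1 hss (Multiset.mem_map_of_mem fP hs) fun t => hcom_sys hss,
      C, hC, rfl, fun c hc => ⟨s, hs, hss, by simpa using hc.symm⟩⟩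
  · rintro v w ⟨C, hC, hv, hc⟩ h1 hvw
    cases hvw with
    | e1 => exact (h1 rfl).elim
    | @e2 M M' c t ht hf =>
      obtain ⟨s, hs, hss, rfl⟩ := hc _ rfl
      obtain rfl : M = C.map fP := hv
      obtain ⟨S, hS, hm⟩ := Multiset.exists_le_map_eq hf.1
      have henv : ∀ s' ∈ S, ¬ G.isSystem (fP s') := fun s' hs' =>
        ht _ (hm ▸ Multiset.mem_map_of_mem fP hs')
      obtain ⟨u, rfl, rfl, hC', hM'⟩ := hfire hC hS hf
        (hσ.exists_instance hC hS hm fun s' hs' h => (henv s' hs' h).elim) hm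
      refine ⟨_, hC', hM', fun c hc => ⟨s, ?_, hss, by simpa using hc.symm⟩⟩
      have hnd := (hσ.bp.occ.nodup_and_concurrent_of_reachable hC).1
      exact Multiset.mem_add.2 (.inl ((Multiset.mem_sub_of_nodup hnd).2
        ⟨hs, fun h => henv s h hss⟩))
    | @e3 M M' c t ht htc hf =>
      obtain ⟨s, hs, hss, rfl⟩ := hc _ rfl
      obtain rfl : M = C.map fP := hv
      obtain ⟨S, hS, hm⟩ := Multiset.exists_le_map_eq hf.1
      obtain ⟨u, -, -, hC', hM'⟩ := hfire hC hS hf (hinst hC hs hss htc hS hm).2 hm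
      exact ⟨_, hC', hM', by simp⟩

end PetriGame.IsWinningStrategy

/-- Raw places of the unfolding: tagged copies of initial places and of the postconditions of
transitions occurring at a finite set of raw places, which is recorded as a list. -/
inductive UnfoldPlace (P T : Type) : Type
  | root (p : P) (k : ℕ)
  | child (t : T) (L : List (UnfoldPlace P T)) (p : P) (k : ℕ)

noncomputable instance (P T : Type) : DecidableEq (UnfoldPlace P T) := Classical.decEq _

/-- Raw transitions of the unfolding: an occurrence of a transition at a set of raw places. -/
@[ext]
structure UnfoldEvent (P T : Type) where
  label : T
  pre : Finset (UnfoldPlace P T)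

noncomputable instance (P T : Type) : DecidableEq (UnfoldEvent P T) := Classical.decEq _

variable {P T : Type}

namespace UnfoldPlace

/-- The place of the original net that a raw place is a copy of. -/
def label : UnfoldPlace P T → P
  | root p _ => p
  | child _ _ p _ => p

/-- The raw places representing the initial marking. -/
def roots [DecidableEq P] (N : PetriNet P T) : Finset (UnfoldPlace P T) :=
  N.init.toEnumFinset.map ⟨fun x => root x.1 x.2, fun x y h => by
    injection h with h₁ h₂
    exact Prod.ext h₁ h₂⟩

theorem map_label_roots [DecidableEq P] (N : PetriNet P T) : (roots N).val.map label = N.init := by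
  rw [roots, Finset.map_val, Multiset.map_map]
  exact Multiset.map_toEnumFinset_fst _

end UnfoldPlace

namespace UnfoldEvent

theorem pre_nonempty {N : PetriNet P T} {e : UnfoldEvent P T}
    (h : e.pre.val.map UnfoldPlace.label = N.pre e.label) : e.pre.Nonempty := by
  rw [Finset.nonempty_iff_ne_empty]
  intro he
  apply N.pre_ne e.label
  rw [← h, he]
  rfl

variable [DecidableEq P] {N : PetriNet P T}

/-- The raw places produced by a raw transition. -/
noncomputable def post (N : PetriNet P T) (e : UnfoldEvent P T) : Finset (UnfoldPlace P T) :=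
  (N.post e.label).toEnumFinset.map
    ⟨fun x => .child e.label e.pre.toList x.1 x.2, fun x y h => by
      injection h with _ _ h₁ h₂
      exact Prod.ext h₁ h₂⟩

theorem map_label_post (N : PetriNet P T) (e : UnfoldEvent P T) :
    (e.post N).val.map UnfoldPlace.label = N.post e.label := by
  rw [post, Finset.map_val, Multiset.map_map]
  exact Multiset.map_toEnumFinset_fst _

theorem mem_post {e : UnfoldEvent P T} {p : UnfoldPlace P T} (h : p ∈ e.post N) :
    ∃ x k, p = .child e.label e.pre.toList x k := by
  obtain ⟨x, -, rfl⟩ := Finset.mem_map.1 h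
  exact ⟨x.1, x.2, rfl⟩

theorem eq_of_mem_post {e e' : UnfoldEvent P T} {p : UnfoldPlace P T}
    (h : p ∈ e.post N) (h' : p ∈ e'.post N) : e = e' := by
  obtain ⟨x, k, rfl⟩ := mem_post h
  obtain ⟨x', k', he⟩ := mem_post h'
  injection he with h₁ h₂
  refine UnfoldEvent.ext h₁ ?_
  rw [← Finset.toList_toFinset e.pre, h₂, Finset.toList_toFinset]

theorem notMem_roots_of_mem_post {e : UnfoldEvent P T} {p : UnfoldPlace P T}
    (h : p ∈ e.post N) : p ∉ UnfoldPlace.roots N := by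
  obtain ⟨x, k, rfl⟩ := mem_post h
  intro hr
  obtain ⟨y, -, hy⟩ := Finset.mem_map.1 hr
  cases hy

theorem sizeOf_lt {e : UnfoldEvent P T} {p q : UnfoldPlace P T}
    (hq : q ∈ e.pre) (hp : p ∈ e.post N) : sizeOf q < sizeOf p := by
  obtain ⟨x, k, rfl⟩ := mem_post hp
  have := List.sizeOf_lt_of_mem (Finset.mem_toList.2 hq)
  rw [UnfoldPlace.child.sizeOf_spec]
  omega

end UnfoldEvent

namespace PetriNet

variable [DecidableEq P] {N : PetriNet P T} {ok : UnfoldEvent P T → Prop}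

/-- The raw places produced by a set of raw transitions, including the initial ones. -/
noncomputable def produced (N : PetriNet P T) (D : Finset (UnfoldEvent P T)) :
    Finset (UnfoldPlace P T) :=
  UnfoldPlace.roots N ∪ D.biUnion (UnfoldEvent.post N)

/-- The raw places produced but not consumed by a set of raw transitions. -/
noncomputable def cut (N : PetriNet P T) (D : Finset (UnfoldEvent P T)) :
    Finset (UnfoldPlace P T) :=
  N.produced D \ D.biUnion UnfoldEvent.pre

/-- The marking of the original net represented by `N.cut D`. -/
noncomputable def cutMarking (N : PetriNet P T) (D : Finset (UnfoldEvent P T)) : Multiset P :=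
  (N.cut D).val.map UnfoldPlace.label

/-- Configurations: causally closed and conflict-free sets of raw transitions, all of which
are permitted by `ok`. -/
structure IsConfig (N : PetriNet P T) (ok : UnfoldEvent P T → Prop)
    (D : Finset (UnfoldEvent P T)) : Prop where
  map_pre : ∀ e ∈ D, e.pre.val.map UnfoldPlace.label = N.pre e.label
  ok : ∀ e ∈ D, ok e
  closed : ∀ e ∈ D, e.pre ⊆ N.produced D
  disjoint : ∀ e ∈ D, ∀ e' ∈ D, e ≠ e' → Disjoint e.pre e'.pre

theorem mem_produced {D : Finset (UnfoldEvent P T)} {p : UnfoldPlace P T} :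
    p ∈ N.produced D ↔ p ∈ UnfoldPlace.roots N ∨ ∃ e ∈ D, p ∈ e.post N := by
  simp [produced]

theorem mem_cut {D : Finset (UnfoldEvent P T)} {p : UnfoldPlace P T} :
    p ∈ N.cut D ↔ p ∈ N.produced D ∧ ∀ e ∈ D, p ∉ e.pre := by
  simp [cut]

theorem mem_of_mem_produced {D : Finset (UnfoldEvent P T)} {e : UnfoldEvent P T}
    {p : UnfoldPlace P T} (hp : p ∈ N.produced D) (he : p ∈ e.post N) : e ∈ D := by
  rcases mem_produced.1 hp with h | ⟨e', he', h⟩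
  · exact (UnfoldEvent.notMem_roots_of_mem_post he h).elim
  · exact UnfoldEvent.eq_of_mem_post he h ▸ he'

theorem produced_mono {D D' : Finset (UnfoldEvent P T)} (h : D ⊆ D') :
    N.produced D ⊆ N.produced D' := by
  intro p hp
  rw [mem_produced] at hp ⊢
  exact hp.imp_right fun ⟨e, he, hpe⟩ => ⟨e, h he, hpe⟩

theorem cut_empty : N.cut ∅ = UnfoldPlace.roots N := by
  simp [cut, produced]

namespace IsConfig

variable {D D' : Finset (UnfoldEvent P T)} {e : UnfoldEvent P T}

theorem empty : N.IsConfig ok ∅ := by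
  constructor <;> simp

theorem of_subset (h : N.IsConfig ok D) (hD : D' ⊆ D)
    (hc : ∀ e ∈ D', e.pre ⊆ N.produced D') : N.IsConfig ok D' where
  map_pre e he := h.map_pre e (hD he)
  ok e he := h.ok e (hD he)
  closed := hc
  disjoint e he e' he' := h.disjoint e (hD he) e' (hD he')

theorem notMem_of_pre_subset_cut
    (hm : e.pre.val.map UnfoldPlace.label = N.pre e.label) (he : e.pre ⊆ N.cut D) : e ∉ D := by
  obtain ⟨p, hp⟩ := UnfoldEvent.pre_nonempty hm
  exact fun h => (mem_cut.1 (he hp)).2 e h hp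

theorem insert (h : N.IsConfig ok D)
    (hm : e.pre.val.map UnfoldPlace.label = N.pre e.label) (hok : ok e)
    (he : e.pre ⊆ N.cut D) : N.IsConfig ok (insert e D) where
  map_pre := Finset.forall_mem_insert _ _ _ |>.2 ⟨hm, h.map_pre⟩
  ok := Finset.forall_mem_insert _ _ _ |>.2 ⟨hok, h.ok⟩
  closed := by
    have hsub := produced_mono (N := N) (Finset.subset_insert e D)
    exact Finset.forall_mem_insert _ _ _ |>.2 ⟨fun p hp => hsub (mem_cut.1 (he hp)).1,
      fun e' he' => (h.closed e' he').trans hsub⟩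
  disjoint := by
    have key : ∀ e' ∈ D, Disjoint e.pre e'.pre := fun e' he' =>
      Finset.disjoint_left.2 fun p hp => (mem_cut.1 (he hp)).2 e' he'
    intro e₁ h₁ e₂ h₂ hne
    obtain h₁ | h₁ := Finset.mem_insert.1 h₁ <;> obtain h₂ | h₂ := Finset.mem_insert.1 h₂
    · exact (hne (h₁.trans h₂.symm)).elim
    · exact h₁ ▸ key e₂ h₂
    · exact h₂ ▸ (key e₁ h₁).symm
    · exact h.disjoint _ h₁ _ h₂ hne

theorem mem_cut_insert (h : N.IsConfig ok D)
    (hm : e.pre.val.map UnfoldPlace.label = N.pre e.label)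
    (he : e.pre ⊆ N.cut D) {p : UnfoldPlace P T} :
    p ∈ N.cut (Insert.insert e D) ↔ (p ∈ N.cut D ∧ p ∉ e.pre) ∨ p ∈ e.post N := by
  have hD := notMem_of_pre_subset_cut hm he
  simp only [mem_cut, mem_produced, Finset.mem_insert, forall_eq_or_imp, exists_eq_or_imp]
  constructor
  · rintro ⟨h₁ | h₁ | h₁, h₂, h₃⟩
    · exact .inl ⟨⟨.inl h₁, h₃⟩, h₂⟩
    · exact .inr h₁
    · exact .inl ⟨⟨.inr h₁, h₃⟩, h₂⟩
  · rintro (⟨⟨h₁, h₃⟩, h₂⟩ | hp)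
    · exact ⟨h₁.imp_right .inr, h₂, h₃⟩
    · refine ⟨.inr (.inl hp), fun hp' => (UnfoldEvent.sizeOf_lt hp' hp).false, ?_⟩
      intro e' he' hp'
      exact hD (mem_of_mem_produced (h.closed e' he' hp') hp)

theorem cut_insert_val (h : N.IsConfig ok D)
    (hm : e.pre.val.map UnfoldPlace.label = N.pre e.label)
    (he : e.pre ⊆ N.cut D) :
    (N.cut (Insert.insert e D)).val = (N.cut D).val - e.pre.val + (e.post N).val := by
  have hdisj : Disjoint (N.cut D \ e.pre) (e.post N) := by
    rw [Finset.disjoint_left]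
    intro p hp hpe
    exact notMem_of_pre_subset_cut hm he
      (mem_of_mem_produced (mem_cut.1 (Finset.mem_sdiff.1 hp).1).1 hpe)
  have : N.cut (Insert.insert e D) = (N.cut D \ e.pre).disjUnion (e.post N) hdisj := by
    ext p
    rw [h.mem_cut_insert hm he, Finset.mem_disjUnion, Finset.mem_sdiff]
  rw [this, Finset.disjUnion_val, Finset.sdiff_val]

theorem fires (h : N.IsConfig ok D)
    (hm : e.pre.val.map UnfoldPlace.label = N.pre e.label) (he : e.pre ⊆ N.cut D) :
    N.Fires (N.cutMarking D) e.label (N.cutMarking (Insert.insert e D)) := by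
  have hle : e.pre.val ≤ (N.cut D).val := Finset.val_le_iff.2 he
  refine ⟨hm ▸ Multiset.map_le_map hle, ?_⟩
  rw [cutMarking, h.cut_insert_val hm he, Multiset.map_add, UnfoldEvent.map_label_post, ← hm,
    Multiset.map_tsub_of_le _ hle, cutMarking]

theorem exists_enabled (hD' : N.IsConfig ok D') (hsub : D ⊆ D') (hne : ¬ D' ⊆ D) :
    ∃ e ∈ D', e ∉ D ∧ e.pre ⊆ N.cut D := by
  obtain ⟨e₀, he₀, hn₀⟩ := Finset.not_subset.1 hne
  obtain ⟨e, he, hmin⟩ := Finset.exists_min_image (D' \ D) (fun e => e.pre.sup sizeOf)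
    ⟨e₀, Finset.mem_sdiff.2 ⟨he₀, hn₀⟩⟩
  rw [Finset.mem_sdiff] at he
  refine ⟨e, he.1, he.2, fun p hp => mem_cut.2 ⟨?_, ?_⟩⟩
  · rcases mem_produced.1 (hD'.closed e he.1 hp) with h | ⟨e', he', hpe'⟩
    · exact mem_produced.2 (.inl h)
    · refine mem_produced.2 (.inr ⟨e', ?_, hpe'⟩)
      by_contra hn
      have h₁ := hmin e' (Finset.mem_sdiff.2 ⟨he', hn⟩)
      have h₂ : sizeOf p ≤ e.pre.sup sizeOf := Finset.le_sup (f := sizeOf) hp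
      have hpos : 0 < sizeOf p := by cases p <;> simp
      have h₃ : e'.pre.sup sizeOf < sizeOf p :=
        (Finset.sup_lt_iff hpos).2 fun q hq => UnfoldEvent.sizeOf_lt hq hpe'
      omega
  · intro e' he' hpe'
    exact Finset.disjoint_left.1 (hD'.disjoint e he.1 e' (hsub he')
      fun h => he.2 (h ▸ he')) hp hpe'

/-- Between nested configurations one can fire the missing transitions one at a time. -/
theorem induction_between (hD : N.IsConfig ok D) (hD' : N.IsConfig ok D') (hsub : D ⊆ D')
    {motive : Finset (UnfoldEvent P T) → Prop} (base : motive D)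
    (step : ∀ Q e, N.IsConfig ok Q → D ⊆ Q → Q ⊆ D' → e ∈ D' → e.pre ⊆ N.cut Q →
      motive Q → motive (Insert.insert e Q)) : motive D' := by
  have key : ∀ n Q, N.IsConfig ok Q → D ⊆ Q → Q ⊆ D' → (D' \ Q).card = n → motive Q →
      motive D' := by
    intro n
    induction n with
    | zero =>
      intro Q _ _ hQ hc hm
      rw [Finset.card_eq_zero, Finset.sdiff_eq_empty_iff_subset] at hc
      exact Finset.Subset.antisymm hQ hc ▸ hm
    | succ n ih =>
      intro Q hQc hDQ hQ hc hm
      obtain ⟨e, he, hne, hpre⟩ := hD'.exists_enabled hQ fun h => by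
        rw [Finset.sdiff_eq_empty_iff_subset.2 h] at hc
        simp at hc
      refine ih _ (hQc.insert (hD'.map_pre e he) (hD'.ok e he) hpre)
        (hDQ.trans (Finset.subset_insert _ _)) (Finset.insert_subset he hQ) ?_
        (step Q e hQc hDQ hQ he hpre hm)
      rw [Finset.sdiff_insert, Finset.card_erase_of_mem (Finset.mem_sdiff.2 ⟨he, hne⟩), hc]
      rfl
  exact key _ D hD subset_rfl hsub rfl base

theorem reachable (hD : N.IsConfig ok D) : N.Reachable (N.cutMarking D) := by
  refine induction_between empty hD (Finset.empty_subset D)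
    (motive := fun Q => N.Reachable (N.cutMarking Q)) ?_ ?_
  · rw [cutMarking, cut_empty, UnfoldPlace.map_label_roots]
    exact .refl
  · intro Q e hQ _ _ he hpre ih
    exact ih.tail ⟨e.label, hQ.fires (hD.map_pre e he) hpre⟩

end IsConfig

/-- `InPast N e p`: the raw transition `e` lies in the causal past of the raw place `p`. -/
inductive InPast (N : PetriNet P T) (e : UnfoldEvent P T) : UnfoldPlace P T → Prop
  | base {p} : p ∈ e.post N → InPast N e p
  | step {p q} {e' : UnfoldEvent P T} : InPast N e q → q ∈ e'.pre → p ∈ e'.post N → InPast N e p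

namespace InPast

variable {D : Finset (UnfoldEvent P T)} {e e' : UnfoldEvent P T} {p q : UnfoldPlace P T}

theorem mem_config (h : InPast N e p) (hD : N.IsConfig ok D) (hp : p ∈ N.produced D) :
    e ∈ D := by
  induction h with
  | base h => exact mem_of_mem_produced hp h
  | step _ hq hp' ih => exact ih (hD.closed _ (mem_of_mem_produced hp hp') hq)

theorem trans (h : InPast N e p) (hq : q ∈ e.pre) (h' : InPast N e' q) : InPast N e' p := by
  induction h with
  | base h => exact .step h' hq h
  | step _ hq' hp' ih => exact .step ih hq' hp'

theorem sizeOf_lt (h : InPast N e p) (hq : q ∈ e.pre) : sizeOf q < sizeOf p := by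
  induction h with
  | base h => exact UnfoldEvent.sizeOf_lt hq h
  | step _ hq' hp' ih => exact ih.trans (UnfoldEvent.sizeOf_lt hq' hp')

end InPast

open Classical in
/-- The causal past of a raw place, if finite. -/
noncomputable def past (N : PetriNet P T) (p : UnfoldPlace P T) : Finset (UnfoldEvent P T) :=
  if h : {e | InPast N e p}.Finite then h.toFinset else ∅

namespace IsConfig

variable {D : Finset (UnfoldEvent P T)} {e : UnfoldEvent P T} {p : UnfoldPlace P T}

theorem mem_past (hD : N.IsConfig ok D) (hp : p ∈ N.produced D) :
    e ∈ N.past p ↔ InPast N e p := by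
  have : {e | InPast N e p}.Finite :=
    D.finite_toSet.subset fun e (he : InPast N e p) => he.mem_config hD hp
  simp [past, this]

theorem past_subset (hD : N.IsConfig ok D) (hp : p ∈ N.produced D) : N.past p ⊆ D :=
  fun _ he => ((hD.mem_past hp).1 he).mem_config hD hp

theorem closed_past (hD : N.IsConfig ok D) (hp : p ∈ N.produced D) (he : e ∈ N.past p) :
    e.pre ⊆ N.produced (N.past p) := by
  intro q hq
  have heD := hD.past_subset hp he
  rw [hD.mem_past hp] at he
  rcases mem_produced.1 (hD.closed e heD hq) with h | ⟨e', -, h⟩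
  · exact mem_produced.2 (.inl h)
  · exact mem_produced.2 (.inr ⟨e', (hD.mem_past hp).2 (he.trans hq (.base h)), h⟩)

theorem isConfig_past (hD : N.IsConfig ok D) (hp : p ∈ N.produced D) :
    N.IsConfig ok (N.past p) :=
  hD.of_subset (hD.past_subset hp) fun _ he => hD.closed_past hp he

theorem mem_produced_past (hD : N.IsConfig ok D) (hp : p ∈ N.produced D) :
    p ∈ N.produced (N.past p) := by
  rcases mem_produced.1 hp with h | ⟨e, -, h⟩
  · exact mem_produced.2 (.inl h)
  · exact mem_produced.2 (.inr ⟨e, (hD.mem_past hp).2 (.base h), h⟩)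

theorem mem_cut_past (hD : N.IsConfig ok D) (hp : p ∈ N.produced D) :
    p ∈ N.cut (N.past p) :=
  mem_cut.2 ⟨hD.mem_produced_past hp, fun _ he hpe =>
    (((hD.mem_past hp).1 he).sizeOf_lt hpe).false⟩

end IsConfig
end PetriNet

namespace PetriNet

variable [DecidableEq P] {N : PetriNet P T} {ok : UnfoldEvent P T → Prop}

/-- The raw places produced by some configuration. -/
abbrev ConfigPlace (N : PetriNet P T) (ok : UnfoldEvent P T → Prop) : Type :=
  {p : UnfoldPlace P T // ∃ D, N.IsConfig ok D ∧ p ∈ N.produced D}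

/-- The raw transitions occurring in some configuration. -/
abbrev ConfigEvent (N : PetriNet P T) (ok : UnfoldEvent P T → Prop) : Type :=
  {e : UnfoldEvent P T // ∃ D, N.IsConfig ok D ∧ e ∈ D}

open Classical in
/-- The multiset of places of the restricted unfolding given by a finite set of raw places. -/
noncomputable def liftPlaces (N : PetriNet P T) (ok : UnfoldEvent P T → Prop)
    (S : Finset (UnfoldPlace P T)) : Multiset (N.ConfigPlace ok) :=
  (S.subtype fun p => ∃ D, N.IsConfig ok D ∧ p ∈ N.produced D).val

theorem mem_liftPlaces {S : Finset (UnfoldPlace P T)} {p : N.ConfigPlace ok} :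
    p ∈ N.liftPlaces ok S ↔ p.1 ∈ S := by
  simp [liftPlaces]

theorem nodup_liftPlaces (S : Finset (UnfoldPlace P T)) : (N.liftPlaces ok S).Nodup :=
  Finset.nodup _

theorem map_val_liftPlaces {S : Finset (UnfoldPlace P T)}
    (h : ∀ p ∈ S, ∃ D, N.IsConfig ok D ∧ p ∈ N.produced D) :
    (N.liftPlaces ok S).map Subtype.val = S.val := by
  classical
  refine Eq.trans ?_ (congrArg Finset.val (Finset.subtype_map_of_mem h))
  rw [Finset.map_val]
  rfl

theorem map_label_liftPlaces {S : Finset (UnfoldPlace P T)}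
    (h : ∀ p ∈ S, ∃ D, N.IsConfig ok D ∧ p ∈ N.produced D) :
    (N.liftPlaces ok S).map (fun p => p.1.label) = S.val.map UnfoldPlace.label := by
  rw [← map_val_liftPlaces h, Multiset.map_map]
  rfl

theorem ConfigEvent.pre_mem (e : N.ConfigEvent ok) :
    ∀ p ∈ e.1.pre, ∃ D, N.IsConfig ok D ∧ p ∈ N.produced D := by
  obtain ⟨e, D, hD, he⟩ := e
  exact fun p hp => ⟨D, hD, hD.closed e he hp⟩

theorem ConfigEvent.post_mem (e : N.ConfigEvent ok) :
    ∀ p ∈ e.1.post N, ∃ D, N.IsConfig ok D ∧ p ∈ N.produced D := by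
  obtain ⟨e, D, hD, he⟩ := e
  exact fun p hp => ⟨D, hD, mem_produced.2 (.inr ⟨e, he, hp⟩)⟩

theorem ConfigEvent.map_pre (e : N.ConfigEvent ok) :
    (N.liftPlaces ok e.1.pre).map (fun p => p.1.label) = N.pre e.1.label := by
  rw [map_label_liftPlaces e.pre_mem]
  obtain ⟨e, D, hD, he⟩ := e
  exact hD.map_pre e he

theorem ConfigEvent.map_post (e : N.ConfigEvent ok) :
    (N.liftPlaces ok (e.1.post N)).map (fun p => p.1.label) = N.post e.1.label := by
  rw [map_label_liftPlaces e.post_mem, UnfoldEvent.map_label_post]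

/-- The unfolding of a net, restricted to the raw transitions permitted by `ok`. -/
noncomputable def unfolding (N : PetriNet P T) (ok : UnfoldEvent P T → Prop) :
    PetriNet (N.ConfigPlace ok) (N.ConfigEvent ok) where
  pre e := N.liftPlaces ok e.1.pre
  post e := N.liftPlaces ok (e.1.post N)
  init := N.liftPlaces ok (UnfoldPlace.roots N)
  pre_ne e h := N.pre_ne e.1.label (by rw [← e.map_pre, h, Multiset.map_zero])
  post_ne e h := N.post_ne e.1.label (by rw [← e.map_post, h, Multiset.map_zero])

theorem roots_mem : ∀ p ∈ UnfoldPlace.roots N, ∃ D, N.IsConfig ok D ∧ p ∈ N.produced D :=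
  fun _ hp => ⟨∅, .empty, mem_produced.2 (.inl hp)⟩

theorem IsConfig.mem_of_cLe {D : Finset (UnfoldEvent P T)} (hD : N.IsConfig ok D)
    {x y : N.ConfigPlace ok ⊕ N.ConfigEvent ok} (h : (N.unfolding ok).CLe x y)
    (hy : Sum.elim (fun p => p.1 ∈ N.produced D) (fun e => e.1 ∈ D) y) :
    Sum.elim (fun p => p.1 ∈ N.produced D) (fun e => e.1 ∈ D) x := by
  induction h using Relation.ReflTransGen.head_induction_on with
  | refl => exact hy
  | @head a b hab _ ih =>
    rcases a with p | e <;> rcases b with q | e'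
    · exact hab.elim
    · exact hD.closed _ ih (mem_liftPlaces.1 hab)
    · exact mem_of_mem_produced ih (mem_liftPlaces.1 hab)
    · exact hab.elim

theorem unfolding_isOccurrence : (N.unfolding ok).IsOccurrence where
  pre_nodup _ := nodup_liftPlaces _
  post_nodup _ := nodup_liftPlaces _
  unique_pre _ _ _ h₁ h₂ :=
    Subtype.ext (UnfoldEvent.eq_of_mem_post (mem_liftPlaces.1 h₁) (mem_liftPlaces.1 h₂))
  init_nodup := nodup_liftPlaces _
  mem_init := by
    rintro ⟨p, D, hD, hp⟩
    refine ⟨fun h e he => UnfoldEvent.notMem_roots_of_mem_post (mem_liftPlaces.1 he)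
      (mem_liftPlaces.1 h), fun h => mem_liftPlaces.2 ?_⟩
    rcases mem_produced.1 hp with h' | ⟨e, he, hpe⟩
    · exact h'
    · exact (h ⟨e, D, hD, he⟩ (mem_liftPlaces.2 hpe)).elim
  wf := by
    refine Subrelation.wf (r := InvImage (· < ·) (Sum.elim (fun p => 2 * sizeOf p.1)
      (fun e => 2 * e.1.pre.sup sizeOf + 1))) ?_ (InvImage.wf _ wellFounded_lt)
    rintro (p | e) (q | e') h
    · exact h.elim
    · have := Finset.le_sup (f := sizeOf) (mem_liftPlaces.1 h)
      simp only [InvImage, Sum.elim_inl, Sum.elim_inr]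
      omega
    · have hpos : 0 < sizeOf q.1 := by cases q.1 <;> simp
      have := (Finset.sup_lt_iff (s := e.1.pre) (f := sizeOf) hpos).2 fun r hr =>
        UnfoldEvent.sizeOf_lt hr (mem_liftPlaces.1 h)
      simp only [InvImage, Sum.elim_inl, Sum.elim_inr]
      omega
    · exact h.elim
  no_self_conflict := by
    rintro ⟨e, D, hD, he⟩ ⟨q, -, -, t₁, t₂, hne, h₁, h₂, hc₁, hc₂⟩
    exact Finset.disjoint_left.1 (hD.disjoint _ (hD.mem_of_cLe hc₁ he) _ (hD.mem_of_cLe hc₂ he)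
      fun h => hne (Subtype.ext h)) (mem_liftPlaces.1 h₁) (mem_liftPlaces.1 h₂)

theorem unfolding_isBranchingProcess :
    IsBranchingProcess (N.unfolding ok) N (fun p => p.1.label) (fun e => e.1.label) where
  occ := unfolding_isOccurrence
  map_pre e := e.map_pre
  map_post e := e.map_post
  map_init := (map_label_liftPlaces roots_mem).trans (UnfoldPlace.map_label_roots N)
  trans_inj e₁ e₂ h hl := by
    refine Subtype.ext (UnfoldEvent.ext hl (Finset.val_injective ?_))
    rw [← map_val_liftPlaces e₁.pre_mem, ← map_val_liftPlaces e₂.pre_mem]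
    exact congrArg _ h

/-- Reachable markings of the restricted unfolding are cuts of configurations. -/
theorem exists_config_of_reachable {M : Multiset (N.ConfigPlace ok)}
    (hM : (N.unfolding ok).Reachable M) :
    ∃ D, N.IsConfig ok D ∧ M.map Subtype.val = (N.cut D).val := by
  induction hM with
  | refl => exact ⟨∅, .empty, by rw [cut_empty]; exact map_val_liftPlaces roots_mem⟩
  | @tail M M' _ hs ih =>
    obtain ⟨e, hle, rfl⟩ := hs
    obtain ⟨D, hD, hMD⟩ := ih
    have hpre : ((N.unfolding ok).pre e).map Subtype.val = e.1.pre.val :=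
      map_val_liftPlaces e.pre_mem
    have hpost : ((N.unfolding ok).post e).map Subtype.val = (e.1.post N).val :=
      map_val_liftPlaces e.post_mem
    have hcut : e.1.pre ⊆ N.cut D := by
      rw [← Finset.val_le_iff, ← hMD, ← hpre]
      exact Multiset.map_le_map hle
    obtain ⟨D₀, hD₀, he₀⟩ := e.2
    refine ⟨insert e.1 D, hD.insert (hD₀.map_pre _ he₀) (hD₀.ok _ he₀) hcut, ?_⟩
    rw [hD.cut_insert_val (hD₀.map_pre _ he₀) hcut, Multiset.map_add,
      Multiset.map_tsub_of_le _ hle, hMD, hpre, hpost]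

theorem InPast.exists_cLe {e : UnfoldEvent P T} {p : UnfoldPlace P T} (h : InPast N e p)
    {D : Finset (UnfoldEvent P T)} (hD : N.IsConfig ok D) (hp : p ∈ N.produced D) :
    ∃ he, (N.unfolding ok).CLe (Sum.inr ⟨e, he⟩) (Sum.inl ⟨p, D, hD, hp⟩) := by
  induction h with
  | base h =>
    exact ⟨⟨D, hD, mem_of_mem_produced hp h⟩, cLe_of_mem_post (mem_liftPlaces.2 h)⟩
  | @step p q e' _ hq hp' ih =>
    have he' := mem_of_mem_produced hp hp'
    obtain ⟨he, hc⟩ := ih (hD.closed e' he' hq)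
    let u : N.ConfigEvent ok := ⟨e', D, hD, he'⟩
    have hqu : ⟨q, D, hD, hD.closed e' he' hq⟩ ∈ (N.unfolding ok).pre u := mem_liftPlaces.2 hq
    have hpu : ⟨p, D, hD, hp⟩ ∈ (N.unfolding ok).post u := mem_liftPlaces.2 hp'
    exact ⟨he, hc.trans ((cLe_of_mem_pre hqu).trans (cLe_of_mem_post hpu))⟩

/-- Finitely many pairwise concurrent places lie in the cut of a common configuration. -/
theorem exists_config_of_concurrent {S : Multiset (N.ConfigPlace ok)}
    (hS : ∀ p ∈ S, ∀ q ∈ S, p ≠ q → (N.unfolding ok).Concurrent (Sum.inl p) (Sum.inl q)) :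
    ∃ D, N.IsConfig ok D ∧ ∀ p ∈ S, p.1 ∈ N.cut D := by
  let D : Finset (UnfoldEvent P T) := S.toFinset.biUnion fun p => N.past p.1
  have hmem : ∀ e, e ∈ D ↔ ∃ p ∈ S, e ∈ N.past p.1 := fun e => by simp [D]
  have hsub : ∀ p ∈ S, N.past p.1 ⊆ D := fun p hp e he => (hmem e).2 ⟨p, hp, he⟩
  have hcfg : ∀ p : N.ConfigPlace ok, N.IsConfig ok (N.past p.1) := by
    rintro ⟨p, D', hD', hp⟩
    exact hD'.isConfig_past hp
  have hcut : ∀ p : N.ConfigPlace ok, p.1 ∈ N.cut (N.past p.1) := by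
    rintro ⟨p, D', hD', hp⟩
    exact hD'.mem_cut_past hp
  have hcLe : ∀ (p : N.ConfigPlace ok) e, e ∈ N.past p.1 →
      ∃ he, (N.unfolding ok).CLe (Sum.inr ⟨e, he⟩) (Sum.inl p) := by
    rintro ⟨p, D', hD', hp⟩ e he
    exact ((hD'.mem_past hp).1 he).exists_cLe hD' hp
  refine ⟨D, ⟨?_, ?_, ?_, ?_⟩, fun p hp => mem_cut.2 ⟨?_, ?_⟩⟩
  · intro e he
    obtain ⟨p, -, he⟩ := (hmem e).1 he
    exact (hcfg p).map_pre e he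
  · intro e he
    obtain ⟨p, -, he⟩ := (hmem e).1 he
    exact (hcfg p).ok e he
  · intro e he
    obtain ⟨p, hp, he⟩ := (hmem e).1 he
    exact ((hcfg p).closed e he).trans (produced_mono (hsub p hp))
  · intro e he e' he' hne
    obtain ⟨p, hp, he⟩ := (hmem e).1 he
    obtain ⟨p', hp', he'⟩ := (hmem e').1 he'
    by_cases hpp : p = p'
    · subst hpp
      exact (hcfg p).disjoint e he e' he' hne
    rw [Finset.disjoint_left]
    intro q hq hq'
    obtain ⟨hv, hc⟩ := hcLe p e he
    obtain ⟨hv', hc'⟩ := hcLe p' e' he'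
    let q₀ : N.ConfigPlace ok := ⟨q, ConfigEvent.pre_mem ⟨e, hv⟩ q hq⟩
    have hq₁ : q₀ ∈ (N.unfolding ok).pre ⟨e, hv⟩ := mem_liftPlaces.2 hq
    have hq₂ : q₀ ∈ (N.unfolding ok).pre ⟨e', hv'⟩ := mem_liftPlaces.2 hq'
    refine (hS p hp p' hp' hpp).2.2 ⟨q₀, ?_, ?_, ⟨e, hv⟩, ⟨e', hv'⟩,
      fun h => hne (congrArg Subtype.val h), hq₁, hq₂, hc, hc'⟩
    · intro h
      obtain rfl : q₀ = p := Sum.inl.inj h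
      exact (mem_cut.1 (hcut q₀)).2 e he hq
    · intro h
      obtain rfl : q₀ = p' := Sum.inl.inj h
      exact (mem_cut.1 (hcut q₀)).2 e' he' hq'
  · exact produced_mono (hsub p hp) (mem_cut.1 (hcut p)).1
  · intro e he hpe
    obtain ⟨p', hp', he⟩ := (hmem e).1 he
    by_cases hpp : p = p'
    · exact (mem_cut.1 (hcut p)).2 e (hpp ▸ he) hpe
    · obtain ⟨hv, hc⟩ := hcLe p' e he
      have hp₀ : p ∈ (N.unfolding ok).pre ⟨e, hv⟩ := mem_liftPlaces.2 hpe
      exact (hS p hp p' hp' hpp).1 ((cLe_of_mem_pre hp₀).trans hc)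

end PetriNet

namespace PetriGame

variable [DecidableEq P] {G : PetriGame P T}

/-- The commitment at a raw place under the memoryless graph strategy `f`: the one chosen in
the marking reached by exactly the causal past of the place. -/
noncomputable def commit (G : PetriGame P T) (f : Multiset P → Set T) (s : UnfoldPlace P T) :
    Set T :=
  f (G.net.cutMarking (G.net.past s))

/-- Raw transitions that all participating system places are committed to. -/
def Permitted (G : PetriGame P T) (f : Multiset P → Set T) (e : UnfoldEvent P T) : Prop :=
  ∀ s ∈ e.pre, G.isSystem s.label → e.label ∈ G.commit f s

variable {f : Multiset P → Set T} {W : GVertex P T → Prop} {D : Finset (UnfoldEvent P T)}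

theorem OneSystemPlayer.cut_system_unique (hone : G.OneSystemPlayer)
    (hD : G.net.IsConfig (G.Permitted f) D) {s s' : UnfoldPlace P T}
    (hs : s ∈ G.net.cut D) (hs' : s' ∈ G.net.cut D)
    (hss : G.isSystem s.label) (hss' : G.isSystem s'.label) : s = s' :=
  hone.system_unique hD.reachable (C := (G.net.cut D).val) hs hs' hss hss'

/-- A memoryless invariant of the graph game holds at all configurations, with the commitment
of the current system place. -/
theorem OneSystemPlayer.invariant_of_isConfig (hone : G.OneSystemPlayer)
    (hinit : W (G.net.init, none)) (hf : ∀ M, W (M, none) → W (M, some (f M)))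
    (hW : ∀ M c w, W (M, some c) → GEdge G (M, some c) w → W w)
    (hD : G.net.IsConfig (G.Permitted f) D) {s : UnfoldPlace P T} (hs : s ∈ G.net.cut D)
    (hss : G.isSystem s.label) : W (G.net.cutMarking D, some (G.commit f s)) := by
  induction hn : D.card using Nat.strong_induction_on generalizing D s with
  | _ n ih =>
    have hprod := (PetriNet.mem_cut.1 hs).1
    have hP := hD.isConfig_past hprod
    have hsP := hD.mem_cut_past hprod
    have hsub := hD.past_subset hprod
    have hnone : W (G.net.cutMarking (G.net.past s), none) := by
      rcases PetriNet.mem_produced.1 hprod with hroot | ⟨e, heD, hse⟩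
      · have : G.net.past s = ∅ := by
          rw [Finset.eq_empty_iff_forall_notMem]
          intro e he
          rcases (hD.mem_past hprod).1 he with h | ⟨-, -, h⟩ <;>
            exact UnfoldEvent.notMem_roots_of_mem_post h hroot
        rw [this, PetriNet.cutMarking, PetriNet.cut_empty, UnfoldPlace.map_label_roots]
        exact hinit
      · have heP : e ∈ G.net.past s := (hD.mem_past hprod).2 (.base hse)
        set Q := (G.net.past s).erase e with hQ
        have hins : insert e Q = G.net.past s := Finset.insert_erase heP
        have hQcfg : G.net.IsConfig (G.Permitted f) Q := by
          refine hP.of_subset (Finset.erase_subset _ _) fun e' he' q hq => ?_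
          have he'P := Finset.mem_of_mem_erase he'
          rcases PetriNet.mem_produced.1 (hP.closed e' he'P hq) with h | ⟨e'', he'', hq''⟩
          · exact PetriNet.mem_produced.2 (.inl h)
          · refine PetriNet.mem_produced.2 (.inr ⟨e'', Finset.mem_erase.2 ⟨?_, he''⟩, hq''⟩)
            rintro rfl
            rcases (hD.mem_past hprod).1 he'P with h | ⟨h, hr, hs'⟩
            · exact Finset.ne_of_mem_erase he' (UnfoldEvent.eq_of_mem_post h hse)
            · obtain rfl := UnfoldEvent.eq_of_mem_post hs' hse
              exact (h.sizeOf_lt hq).not_gt (UnfoldEvent.sizeOf_lt hr hq'')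
        have hpre : e.pre ⊆ G.net.cut Q := by
          intro q hq
          refine PetriNet.mem_cut.2 ⟨?_, fun e' he' hq' => ?_⟩
          · rcases PetriNet.mem_produced.1 (hP.closed e heP hq) with h | ⟨e', he', hq'⟩
            · exact PetriNet.mem_produced.2 (.inl h)
            · refine PetriNet.mem_produced.2 (.inr ⟨e', Finset.mem_erase.2 ⟨?_, he'⟩, hq'⟩)
              rintro rfl
              exact (UnfoldEvent.sizeOf_lt hq hq').false
          · obtain ⟨hne, he'P⟩ := Finset.mem_erase.1 he'
            exact Finset.disjoint_left.1 (hP.disjoint e' he'P e heP hne) hq' hq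
        have hmap := hP.map_pre e heP
        have hfire := hQcfg.fires hmap hpre
        have hcut := fun p => hQcfg.mem_cut_insert hmap hpre (p := p)
        rw [hins] at hfire hcut
        obtain ⟨s₀, hs₀, hss₀⟩ := hone.exists_system hQcfg.reachable
        have hs₀e : s₀ ∈ e.pre := by
          by_contra hn
          have : s₀ = s := hone.cut_system_unique hP ((hcut s₀).2 (.inl ⟨hs₀, hn⟩)) hsP hss₀ hss
          have hmem := PetriNet.mem_of_mem_produced (PetriNet.mem_cut.1 hs₀).1 (this ▸ hse)
          exact Finset.notMem_erase e _ hmem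
        refine hW _ _ _ (ih _ ?_ hQcfg hs₀ hss₀ rfl) (.e3 ⟨s₀.label, ?_, hss₀⟩
          (hP.ok e heP s₀ hs₀e hss₀) hfire)
        · rw [← hn]
          exact (Finset.card_erase_lt_of_mem heP).trans_le (Finset.card_le_card hsub)
        · rw [← hmap]
          exact Multiset.mem_map_of_mem _ hs₀e
    refine hP.induction_between hD hsub
      (motive := fun Q => W (G.net.cutMarking Q, some (G.commit f s))) (hf _ hnone) ?_
    intro Q e hQ hPQ hQD heD hpre hWQ
    have hmap := hD.map_pre e heD
    refine hW _ _ _ hWQ (.e2 ?_ (hQ.fires hmap hpre))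
    intro p hp hps
    rw [← hmap] at hp
    obtain ⟨s₁, hs₁, rfl⟩ := Multiset.mem_map.1 hp
    have hsQ : s ∈ G.net.cut Q := PetriNet.mem_cut.2
      ⟨PetriNet.produced_mono hPQ (PetriNet.mem_cut.1 hsP).1,
        fun e' he' => (PetriNet.mem_cut.1 hs).2 e' (hQD he')⟩
    have := hone.cut_system_unique hQ (hpre hs₁) hsQ hps hss
    exact (PetriNet.mem_cut.1 hs).2 e heD (this ▸ hs₁)

end PetriGame

namespace PetriGame

variable [DecidableEq P] {G : PetriGame P T}

theorem hasWinningStrategy_of_graph (hone : G.OneSystemPlayer)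
    (h : G.HasWinningGraphStrategy) : G.HasWinningStrategy := by
  obtain ⟨W, hinit, hbad, h0, h1⟩ := winningP0_iff_exists_invariant.1 h
  have hex : ∀ M, ∃ c, W (M, none) → W (M, some c) := by
    intro M
    by_cases hM : W (M, none)
    · obtain ⟨w, hw, hWw⟩ := h0 _ hM rfl
      cases hw with
      | @e1 _ c => exact ⟨c, fun _ => hWw⟩
    · exact ⟨∅, fun h => (hM h).elim⟩
  choose f hf using hex
  let N' := G.net.unfolding (G.Permitted f)
  have hbp : IsBranchingProcess N' G.net _ _ := PetriNet.unfolding_isBranchingProcess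
  -- The invariant holds at the cut of a reachable marking.
  have hcfg : ∀ M, N'.Reachable M → ∃ D, G.net.IsConfig (G.Permitted f) D ∧
      M.map Subtype.val = (G.net.cut D).val ∧
      M.map (fun p => p.1.label) = G.net.cutMarking D := by
    intro M hM
    obtain ⟨D, hD, hMD⟩ := PetriNet.exists_config_of_reachable hM
    refine ⟨D, hD, hMD, ?_⟩
    rw [PetriNet.cutMarking, ← hMD, Multiset.map_map]
    rfl
  have hinv : ∀ {D s}, G.net.IsConfig (G.Permitted f) D → s ∈ G.net.cut D →
      G.isSystem s.label → ¬ GBad G (G.net.cutMarking D, some (G.commit f s)) :=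
    fun hD hs hss => hbad _ (hone.invariant_of_isConfig hinit hf
      (fun M c w hw he => h1 _ w hw (by simp) he) hD hs hss)
  have hev : ∀ (e : G.net.ConfigEvent (G.Permitted f)) M D, N'.Enabled M e →
      M.map Subtype.val = (G.net.cut D).val → e.1.pre ⊆ G.net.cut D := by
    intro e M D he hMD
    rw [← Finset.val_le_iff, ← hMD, ← PetriNet.map_val_liftPlaces e.pre_mem]
    exact Multiset.map_le_map he
  have hok : ∀ e : G.net.ConfigEvent (G.Permitted f), G.Permitted f e.1 ∧
      e.1.pre.val.map UnfoldPlace.label = G.net.pre e.1.label := by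
    rintro ⟨e, D, hD, he⟩
    exact ⟨hD.ok e he, hD.map_pre e he⟩
  refine ⟨_, _, inferInstance, N', _, _, hbp, ?_, ?_, ?_, ?_⟩
  · intro S t hSnd hS hSt hno
    by_contra! hcon
    obtain ⟨D, hD, hSD⟩ := PetriNet.exists_config_of_concurrent hS
    have hnd : (S.map Subtype.val).Nodup := hSnd.map Subtype.val_injective
    let e : UnfoldEvent P T := ⟨t, ⟨S.map Subtype.val, hnd⟩⟩
    have hmem : ∀ p, p ∈ e.pre ↔ ∃ q ∈ S, q.1 = p := fun p => Multiset.mem_map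
    have hmap : e.pre.val.map UnfoldPlace.label = G.net.pre e.label := by
      rw [← hSt]
      exact Multiset.map_map _ _ _
    have hcut : e.pre ⊆ G.net.cut D := by
      intro p hp
      obtain ⟨q, hq, rfl⟩ := (hmem p).1 hp
      exact hSD q hq
    have hperm : G.Permitted f e := by
      intro s hs hss
      obtain ⟨q, hq, rfl⟩ := (hmem s).1 hs
      obtain ⟨u, hu, hut⟩ := hcon q hq hss
      have := (hok u).1 q.1 (PetriNet.mem_liftPlaces.1 hu) hss
      rwa [hut] at this
    let e' : G.net.ConfigEvent (G.Permitted f) :=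
      ⟨e, _, hD.insert hmap hperm hcut, Finset.mem_insert_self _ _⟩
    refine hno ⟨e', rfl, Multiset.map_injective Subtype.val_injective ?_⟩
    exact PetriNet.map_val_liftPlaces e'.pre_mem
  · intro M hM hMb
    obtain ⟨D, hD, -, hMD⟩ := hcfg M hM
    obtain ⟨s, hs, hss⟩ := hone.exists_system hD.reachable
    exact hinv hD hs hss (.inl (hMD ▸ hMb))
  · intro s hss M hM hsM t₁ t₂ hs₁ hs₂ he₁ he₂
    obtain ⟨D, hD, hMval, hMD⟩ := hcfg M hM
    have hs : s.1 ∈ G.net.cut D := by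
      rw [← Finset.mem_val, ← hMval]
      exact Multiset.mem_map_of_mem _ hsM
    have hc₁ := (hok t₁).1 s.1 (PetriNet.mem_liftPlaces.1 hs₁) hss
    have hc₂ := (hok t₂).1 s.1 (PetriNet.mem_liftPlaces.1 hs₂) hss
    have hpre₁ := hev t₁ M D he₁ hMval
    have hpre₂ := hev t₂ M D he₂ hMval
    have hen : ∀ t : G.net.ConfigEvent (G.Permitted f), t.1.pre ⊆ G.net.cut D →
        G.net.Enabled (G.net.cutMarking D) t.1.label := fun t ht =>
      (hok t).2.symm.trans_le (Multiset.map_le_map (Finset.val_le_iff.2 ht))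
    have hlab : t₁.1.label = t₂.1.label := by
      by_contra hne
      exact hinv hD hs hss (.inr (.inl ⟨_, hc₁, _, hc₂, hne, hen t₁ hpre₁, hen t₂ hpre₂⟩))
    refine Subtype.ext (UnfoldEvent.ext hlab ?_)
    by_contra hne
    have hmap : t₁.1.pre.val.map UnfoldPlace.label = t₂.1.pre.val.map UnfoldPlace.label := by
      rw [(hok t₁).2, (hok t₂).2, hlab]
    have hcard : t₁.1.pre.card = t₂.1.pre.card := by
      simpa using congrArg Multiset.card hmap
    obtain ⟨x, hx₁, hx₂⟩ := Finset.not_subset.1 fun hsub =>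
      hne (Finset.eq_of_subset_of_card_le hsub hcard.ge)
    refine hinv hD hs hss (.inr (.inr (.inl ⟨_, hc₂, hen t₂ hpre₂, x.label, ?_, ?_⟩)))
    · rw [← hlab, ← (hok t₁).2]
      exact Multiset.count_pos.2 (Multiset.mem_map_of_mem _ hx₁)
    · have hle : x ::ₘ t₂.1.pre.val ≤ (G.net.cut D).val := by
        rw [← Finset.cons_val hx₂]
        exact Finset.val_le_iff.2 (Finset.cons_subset.2 ⟨hpre₁ hx₁, hpre₂⟩)
      have := Multiset.count_le_of_le x.label
        (Multiset.map_le_map (f := UnfoldPlace.label) hle)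
      rw [Multiset.map_cons, Multiset.count_cons_self, (hok t₂).2] at this
      exact this
  · intro M hM hen
    obtain ⟨D, hD, hMval, hMD⟩ := hcfg M hM
    obtain ⟨s, hs, hss⟩ := hone.exists_system hD.reachable
    rw [hMD] at hen
    obtain ⟨t, ht, htc⟩ : ∃ t, G.net.Enabled (G.net.cutMarking D) t ∧
        (G.SysTrans t → t ∈ G.commit f s) := by
      by_contra! hcon
      exact hinv hD hs hss (.inr (.inr (.inr ⟨hen, hcon⟩)))
    obtain ⟨S, hS, hSt⟩ := Multiset.exists_le_map_eq ht
    let e : UnfoldEvent P T := ⟨t, ⟨S, Multiset.nodup_of_le hS (Finset.nodup _)⟩⟩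
    have hcut : e.pre ⊆ G.net.cut D := Finset.val_le_iff.1 hS
    have hperm : G.Permitted f e := by
      intro s' hs' hss'
      obtain rfl : s' = s := hone.cut_system_unique hD (hcut hs') hs hss' hss
      exact htc ⟨_, hSt ▸ Multiset.mem_map_of_mem _ hs', hss'⟩
    let e' : G.net.ConfigEvent (G.Permitted f) :=
      ⟨e, _, hD.insert hSt hperm hcut, Finset.mem_insert_self _ _⟩
    refine ⟨e', (Multiset.map_le_map_iff Subtype.val_injective).1 ?_⟩
    rw [hMval]
    exact (PetriNet.map_val_liftPlaces e'.pre_mem).trans_le hS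

end PetriGame

/-- A bounded Petri game with one system player admits a winning,
deadlock-avoiding strategy iff Player 0 has a winning strategy in the finite
graph game `Graph(G)`. -/
theorem petriGame_iff_graphGame {P T : Type} [DecidableEq P] [Finite P] [Finite T]
    (G : PetriGame P T) (hbounded : G.Bounded) (hone : G.OneSystemPlayer) :
    G.HasWinningStrategy ↔ G.HasWinningGraphStrategy := by
  exact ⟨fun ⟨_, _, _, _, _, _, hσ⟩ => hσ.hasWinningGraphStrategy hone,
    PetriGame.hasWinningStrategy_of_graph hone⟩
end

section
/- Let G be a bounded Petri game with one system player. If G has a winning, deadlock-avoiding strategy, then Player 0 has a winning strategy in the graph game Graph(G). -/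
namespace PetriNet

/-- `K` is the marking reached by firing exactly the transitions of the configuration `F`. -/
structure IsConfiguration {P T : Type} (N : PetriNet P T) (K : Multiset P) (F : Set T) : Prop where
  nodup : K.Nodup
  downward_closed : ∀ t ∈ F, ∀ p ∈ N.pre t, ∀ t', p ∈ N.post t' → t' ∈ F
  conflict_free : ∀ t₁ ∈ F, ∀ t₂ ∈ F, ∀ p, p ∈ N.pre t₁ → p ∈ N.pre t₂ → t₁ = t₂
  mem_iff : ∀ p, p ∈ K ↔ (p ∈ N.init ∨ ∃ t ∈ F, p ∈ N.post t) ∧ ∀ t ∈ F, p ∉ N.pre t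

theorem IsOccurrence.isConfiguration_init {P T : Type} {N : PetriNet P T} (hN : N.IsOccurrence) :
    N.IsConfiguration N.init ∅ :=
  ⟨hN.init_nodup, by simp, by simp, by simp⟩

theorem IsConfiguration.fire {P T : Type} [DecidableEq P] {N : PetriNet P T}
    (hN : N.IsOccurrence) {K K' : Multiset P} {F : Set T} (hK : N.IsConfiguration K F) {t : T}
    (ht : N.Fires K t K') : N.IsConfiguration K' (insert t F) := by
  obtain ⟨hle, rfl⟩ := ht
  have hpre : ∀ p ∈ N.pre t, p ∈ K := fun p hp => Multiset.mem_of_le hle hp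
  have htF : t ∉ F := by
    intro htF
    obtain ⟨p, hp⟩ := Multiset.exists_mem_of_ne_zero (N.pre_ne t)
    exact ((hK.mem_iff p).1 (hpre p hp)).2 t htF hp
  have hprod : ∀ p ∈ K, ∀ t', p ∈ N.post t' → t' ∈ F := by
    intro p hp t' ht'
    rcases ((hK.mem_iff p).1 hp).1 with h | ⟨t'', h, h'⟩
    · exact absurd ht' ((hN.mem_init p).1 h t')
    · exact hN.unique_pre p t' t'' ht' h' ▸ h
  have hpost : ∀ p ∈ N.post t, p ∉ K := fun p hp hpK => htF (hprod p hpK t hp)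
  have hsub : ∀ p, p ∈ K - N.pre t ↔ p ∈ K ∧ p ∉ N.pre t := fun p =>
    Multiset.mem_sub_of_nodup hK.nodup
  refine ⟨?_, ?_, ?_, ?_⟩
  · refine Multiset.nodup_add.2 ⟨Multiset.nodup_of_le (Multiset.sub_le_self _ _) hK.nodup,
      hN.post_nodup t, ?_⟩
    exact Multiset.disjoint_left.2 fun {p} hp hp' => hpost p hp' ((hsub p).1 hp).1
  · rintro t₁ (rfl | h₁) p hp t' ht'
    · exact Or.inr (hprod p (hpre p hp) t' ht')
    · exact Or.inr (hK.downward_closed t₁ h₁ p hp t' ht')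
  · rintro t₁ (rfl | h₁) t₂ (rfl | h₂) p hp hp'
    · rfl
    · exact absurd hp' (((hK.mem_iff p).1 (hpre p hp)).2 t₂ h₂)
    · exact absurd hp (((hK.mem_iff p).1 (hpre p hp')).2 t₁ h₁)
    · exact hK.conflict_free t₁ h₁ t₂ h₂ p hp hp'
  · intro p
    rw [Multiset.mem_add, hsub]
    constructor
    · rintro (⟨hp, hpt⟩ | hp)
      · obtain ⟨h, h'⟩ := (hK.mem_iff p).1 hp
        refine ⟨h.imp_right fun ⟨u, hu, hu'⟩ => ⟨u, Or.inr hu, hu'⟩, ?_⟩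
        rintro u (rfl | hu)
        exacts [hpt, h' u hu]
      · refine ⟨Or.inr ⟨t, Or.inl rfl, hp⟩, ?_⟩
        rintro u (rfl | hu) hpu
        · exact hpost p hp (hpre p hpu)
        · exact htF (hK.downward_closed u hu p hpu t hp)
    · rintro ⟨h, h'⟩
      have hpt := h' t (Or.inl rfl)
      have hF : ∀ u ∈ F, p ∉ N.pre u := fun u hu => h' u (Or.inr hu)
      rcases h with h | ⟨u, rfl | hu, hpu⟩
      · exact Or.inl ⟨(hK.mem_iff p).2 ⟨Or.inl h, hF⟩, hpt⟩
      · exact Or.inr hpu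
      · exact Or.inl ⟨(hK.mem_iff p).2 ⟨Or.inr ⟨u, hu, hpu⟩, hF⟩, hpt⟩

theorem IsOccurrence.exists_isConfiguration {P T : Type} [DecidableEq P] {N : PetriNet P T}
    (hN : N.IsOccurrence) {K : Multiset P} (hK : N.Reachable K) :
    ∃ F, N.IsConfiguration K F := by
  induction hK with
  | refl => exact ⟨∅, hN.isConfiguration_init⟩
  | tail _ hstep ih =>
    obtain ⟨F, hF⟩ := ih
    obtain ⟨t, ht⟩ := hstep
    exact ⟨insert t F, hF.fire hN ht⟩

/-- Every transition in the causal past of a place of `K` has been fired. -/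
theorem IsConfiguration.mem_of_cLe {P T : Type} {N : PetriNet P T}
    (hN : N.IsOccurrence) {K : Multiset P} {F : Set T} (hK : N.IsConfiguration K F)
    {t : T} {q : P} (hq : q ∈ K) (h : N.CLe (Sum.inr t) (Sum.inl q)) : t ∈ F := by
  let D : P ⊕ T → Prop := Sum.elim (fun p => ∀ u, p ∈ N.post u → u ∈ F) (fun u => u ∈ F)
  suffices H : ∀ x, N.CLe x (Sum.inl q) → D x from H _ h
  intro x hx
  induction hx using Relation.ReflTransGen.head_induction_on with
  | refl =>
    intro u hu
    rcases ((hK.mem_iff q).1 hq).1 with h | ⟨u', h, h'⟩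
    · exact absurd hu ((hN.mem_init q).1 h u)
    · exact hN.unique_pre q u u' hu h' ▸ h
  | @head a b hab _ ih =>
    rcases a with p | u <;> rcases b with p' | u'
    · exact hab.elim
    · exact fun v hv => hK.downward_closed u' ih p hab v hv
    · exact ih u hab
    · exact hab.elim

theorem IsConfiguration.not_cLe {P T : Type} {N : PetriNet P T}
    (hN : N.IsOccurrence) {K : Multiset P} {F : Set T} (hK : N.IsConfiguration K F)
    {p q : P} (hp : p ∈ K) (hq : q ∈ K) (hpq : p ≠ q) : ¬ N.CLe (Sum.inl p) (Sum.inl q) := by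
  intro h
  rcases Relation.ReflTransGen.cases_head h with h | ⟨p' | t, hpt, htq⟩
  · exact hpq (Sum.inl_injective h)
  · exact hpt.elim
  · exact ((hK.mem_iff p).1 hp).2 t (hK.mem_of_cLe hN hq htq) hpt

theorem IsConfiguration.concurrent {P T : Type} {N : PetriNet P T}
    (hN : N.IsOccurrence) {K : Multiset P} {F : Set T} (hK : N.IsConfiguration K F)
    {p q : P} (hp : p ∈ K) (hq : q ∈ K) (hpq : p ≠ q) :
    N.Concurrent (Sum.inl p) (Sum.inl q) := by
  refine ⟨hK.not_cLe hN hp hq hpq, hK.not_cLe hN hq hp hpq.symm, ?_⟩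
  rintro ⟨r, -, -, t₁, t₂, hne, h₁, h₂, hp', hq'⟩
  exact hne (hK.conflict_free t₁ (hK.mem_of_cLe hN hp hp') t₂ (hK.mem_of_cLe hN hq hq') r h₁ h₂)

end PetriNet

theorem Multiset.exists_le_map_eq_s1 {α β : Type*} {f : α → β} {K : Multiset α} {M : Multiset β}
    (h : M ≤ K.map f) : ∃ S ≤ K, S.map f = M := by
  classical
  induction K using Multiset.induction_on generalizing M with
  | empty => exact ⟨0, le_rfl, (Multiset.le_zero.1 h).symm⟩
  | cons a K ih =>
    rw [Multiset.map_cons] at h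
    by_cases ha : f a ∈ M
    · obtain ⟨S, hS, hM⟩ := ih (Multiset.erase_le_iff_le_cons.2 h)
      exact ⟨a ::ₘ S, Multiset.cons_le_cons a hS, by
        rw [Multiset.map_cons, hM, Multiset.cons_erase ha]⟩
    · obtain ⟨S, hS, hM⟩ := ih ((Multiset.le_cons_of_notMem ha).1 h)
      exact ⟨S, hS.trans (Multiset.le_cons_self K a), hM⟩

namespace IsBranchingProcess

variable {P₁ T₁ P₂ T₂ : Type} {N₁ : PetriNet P₁ T₁} {N₂ : PetriNet P₂ T₂}
  {fP : P₁ → P₂} {fT : T₁ → T₂}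

theorem enabled_map (h : IsBranchingProcess N₁ N₂ fP fT) {K : Multiset P₁} {t : T₁}
    (ht : N₁.Enabled K t) : N₂.Enabled (K.map fP) (fT t) := by
  unfold PetriNet.Enabled
  rw [← h.map_pre]
  exact Multiset.map_le_map ht

theorem map_fire [DecidableEq P₁] [DecidableEq P₂] (h : IsBranchingProcess N₁ N₂ fP fT)
    {K : Multiset P₁} {t : T₁} (ht : N₁.Enabled K t) :
    (K - N₁.pre t + N₁.post t).map fP = K.map fP - N₂.pre (fT t) + N₂.post (fT t) := by
  obtain ⟨R, rfl⟩ := Multiset.le_iff_exists_add.1 ht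
  simp [← h.map_pre, ← h.map_post]

theorem reachable_map_s1 [DecidableEq P₁] [DecidableEq P₂] (h : IsBranchingProcess N₁ N₂ fP fT)
    {K : Multiset P₁} (hK : N₁.Reachable K) : N₂.Reachable (K.map fP) := by
  induction hK with
  | refl => rw [h.map_init]; exact Relation.ReflTransGen.refl
  | tail _ hstep ih =>
    obtain ⟨t, ht, rfl⟩ := hstep
    exact ih.tail ⟨fT t, h.enabled_map ht, h.map_fire ht⟩

end IsBranchingProcess

namespace PetriGame

/-- The labels of the transitions that a strategy offers at a place `s`. -/
def commitmentAt {T P' T' : Type} (N' : PetriNet P' T') (fT : T' → T) (s : P') : Set T :=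
  fT '' {t | s ∈ N'.pre t}

/-- `K` is a reachable marking of the strategy that witnesses the vertex `v` of the graph game. -/
structure Witnesses {P T P' T' : Type} [DecidableEq P'] (G : PetriGame P T)
    (N' : PetriNet P' T') (fP : P' → P) (fT : T' → T) (K : Multiset P') (v : GVertex P T) :
    Prop where
  reachable : N'.Reachable K
  map_eq : K.map fP = v.1
  commitment : ∀ c, v.2 = some c → ∃ s ∈ K, G.isSystem (fP s) ∧ c = commitmentAt N' fT s

theorem IsWinningStrategy.exists_transition {P T P' T' : Type} [DecidableEq P] [DecidableEq P']
    {G : PetriGame P T} {N' : PetriNet P' T'} {fP : P' → P} {fT : T' → T}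
    (h : IsWinningStrategy G N' fP fT) {K S : Multiset P'} (hK : N'.Reachable K) (hS : S ≤ K)
    {t : T} (hSt : S.map fP = G.net.pre t)
    (hoffer : ∀ s ∈ S, G.isSystem (fP s) → t ∈ commitmentAt N' fT s) :
    ∃ t', fT t' = t ∧ N'.pre t' = S := by
  by_contra hno
  obtain ⟨F, hF⟩ := h.bp.occ.exists_isConfiguration hK
  obtain ⟨s, hs, hsys, hs'⟩ := h.justified_refusal S t (Multiset.nodup_of_le hS hF.nodup)
    (fun p hp q hq hpq => hF.concurrent h.bp.occ (Multiset.mem_of_le hS hp)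
      (Multiset.mem_of_le hS hq) hpq) hSt hno
  obtain ⟨u, hu, hut⟩ := hoffer s hs hsys
  exact hs' u hu hut

theorem eq_of_isSystem {P T P' : Type} [DecidableEq P] {G : PetriGame P T}
    (hone : G.OneSystemPlayer) {fP : P' → P} {K : Multiset P'} (hK : G.net.Reachable (K.map fP))
    {s₁ s₂ : P'} (h₁ : s₁ ∈ K) (h₂ : s₂ ∈ K) (hs₁ : G.isSystem (fP s₁))
    (hs₂ : G.isSystem (fP s₂)) : s₁ = s₂ := by
  by_contra hne
  obtain ⟨s, -, hcount, huniq⟩ := hone _ hK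
  have e₁ := huniq _ hs₁ (Multiset.mem_map_of_mem fP h₁)
  have e₂ := huniq _ hs₂ (Multiset.mem_map_of_mem fP h₂)
  obtain ⟨K₁, rfl⟩ := Multiset.exists_cons_of_mem h₁
  obtain ⟨K₂, rfl⟩ := Multiset.exists_cons_of_mem
    ((Multiset.mem_cons.1 h₂).resolve_left (Ne.symm hne))
  simp [e₁, e₂] at hcount

section Witnesses

variable {P T P' T' : Type} [DecidableEq P] [DecidableEq P'] {G : PetriGame P T}
  {N' : PetriNet P' T'} {fP : P' → P} {fT : T' → T} {K : Multiset P'}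

theorem Witnesses.exists_edge (h : IsWinningStrategy G N' fP fT) (hone : G.OneSystemPlayer)
    {v : GVertex P T} (hK : Witnesses G N' fP fT K v) (hv : v.2 = none) :
    ∃ w, GEdge G v w ∧ Witnesses G N' fP fT K w := by
  obtain ⟨M, o⟩ := v
  obtain rfl : o = none := hv
  obtain ⟨hreach, rfl : K.map fP = M, -⟩ := hK
  obtain ⟨s₀, hsys, hcount, -⟩ := hone _ (h.bp.reachable_map_s1 hreach)
  have hmem : s₀ ∈ K.map fP := Multiset.count_pos.1 (by omega)
  obtain ⟨s, hs, rfl⟩ := Multiset.mem_map.1 hmem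
  refine ⟨(K.map fP, some (commitmentAt N' fT s)), GEdge.e1 hsys hmem ?_, hreach, rfl, ?_⟩
  · rintro _ ⟨t, ht, rfl⟩
    change fP s ∈ G.net.pre (fT t)
    rw [← h.bp.map_pre]
    exact Multiset.mem_map_of_mem fP ht
  · rintro c hc
    exact ⟨s, hs, hsys, (Option.some_injective _ hc).symm⟩

/-- A committed transition can be realised from every matching set of places of `K`. -/
theorem IsWinningStrategy.exists_transition_of_mem (h : IsWinningStrategy G N' fP fT)
    (hone : G.OneSystemPlayer) (hK : N'.Reachable K) {s : P'} (hs : s ∈ K)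
    (hsys : G.isSystem (fP s)) {S : Multiset P'} (hS : S ≤ K) {t : T}
    (hSt : S.map fP = G.net.pre t) (ht : t ∈ commitmentAt N' fT s) :
    ∃ t', fT t' = t ∧ N'.pre t' = S :=
  h.exists_transition hK hS hSt fun _ hs' hsys' =>
    eq_of_isSystem hone (h.bp.reachable_map_s1 hK) hs (Multiset.mem_of_le hS hs') hsys hsys' ▸ ht

theorem Witnesses.exists_of_edge (h : IsWinningStrategy G N' fP fT) (hone : G.OneSystemPlayer)
    {v w : GVertex P T} (hK : Witnesses G N' fP fT K v) (hv : v.2 ≠ none) (hvw : GEdge G v w) :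
    ∃ K', Witnesses G N' fP fT K' w := by
  obtain ⟨hreach, hmap, hcom⟩ := hK
  cases hvw with
  | e1 => exact absurd rfl hv
  | @e2 M M' c t henv hfire =>
    obtain rfl : K.map fP = M := hmap
    obtain ⟨hle, rfl⟩ := hfire
    obtain ⟨S, hS, hSt⟩ := Multiset.exists_le_map_eq_s1 hle
    have hSenv : ∀ s ∈ S, ¬ G.isSystem (fP s) := fun s hs =>
      henv _ (hSt ▸ Multiset.mem_map_of_mem fP hs)
    obtain ⟨t', rfl, rfl⟩ := h.exists_transition hreach hS hSt
      fun s hs hsys => absurd hsys (hSenv s hs)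
    refine ⟨_, hreach.tail ⟨t', hS, rfl⟩, h.bp.map_fire hS, fun d hd => ?_⟩
    obtain ⟨s, hs, hsys, hc⟩ := hcom d hd
    have hsS : s ∉ N'.pre t' := fun hs' => hSenv s hs' hsys
    refine ⟨s, Multiset.mem_add.2 (Or.inl (Multiset.count_pos.1 ?_)), hsys, hc⟩
    rw [Multiset.count_sub, Multiset.count_eq_zero.2 hsS]
    exact Multiset.count_pos.2 hs
  | @e3 M M' c t _ htc hfire =>
    obtain rfl : K.map fP = M := hmap
    obtain ⟨hle, rfl⟩ := hfire
    obtain ⟨s, hs, hsys, rfl⟩ := hcom c rfl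
    obtain ⟨S, hS, hSt⟩ := Multiset.exists_le_map_eq_s1 hle
    obtain ⟨t', rfl, rfl⟩ :=
      h.exists_transition_of_mem hone hreach hs hsys hS hSt htc
    exact ⟨_, hreach.tail ⟨t', hS, rfl⟩, h.bp.map_fire hS, fun d hd => by cases hd⟩

theorem IsWinningStrategy.mem_of_mem_commitmentAt (h : IsWinningStrategy G N' fP fT)
    (hone : G.OneSystemPlayer) (hK : N'.Reachable K) {s : P'} (hs : s ∈ K)
    (hsys : G.isSystem (fP s)) {S : Multiset P'} (hS : S ≤ K) {t : T}
    (hSt : S.map fP = G.net.pre t) (ht : t ∈ commitmentAt N' fT s) : s ∈ S := by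
  obtain ⟨u, hu, rfl⟩ := ht
  have hmem : fP s ∈ S.map fP := by
    rw [hSt, ← h.bp.map_pre]
    exact Multiset.mem_map_of_mem fP hu
  obtain ⟨s', hs', he⟩ := Multiset.mem_map.1 hmem
  exact eq_of_isSystem hone (h.bp.reachable_map_s1 hK) (Multiset.mem_of_le hS hs') hs
    (he ▸ hsys) hsys ▸ hs'

/-- At a reachable marking, a strategy realises at most one committed transition, and from only
one set of places. -/
theorem IsWinningStrategy.committed_unique (h : IsWinningStrategy G N' fP fT)
    (hone : G.OneSystemPlayer) (hK : N'.Reachable K) {s : P'} (hs : s ∈ K)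
    (hsys : G.isSystem (fP s)) {S₁ S₂ : Multiset P'} (hS₁ : S₁ ≤ K) (hS₂ : S₂ ≤ K) {t₁ t₂ : T}
    (hSt₁ : S₁.map fP = G.net.pre t₁) (hSt₂ : S₂.map fP = G.net.pre t₂)
    (ht₁ : t₁ ∈ commitmentAt N' fT s) (ht₂ : t₂ ∈ commitmentAt N' fT s) :
    t₁ = t₂ ∧ S₁ = S₂ := by
  have hs₁ := h.mem_of_mem_commitmentAt hone hK hs hsys hS₁ hSt₁ ht₁
  have hs₂ := h.mem_of_mem_commitmentAt hone hK hs hsys hS₂ hSt₂ ht₂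
  obtain ⟨u₁, rfl, rfl⟩ := h.exists_transition_of_mem hone hK hs hsys hS₁ hSt₁ ht₁
  obtain ⟨u₂, rfl, rfl⟩ := h.exists_transition_of_mem hone hK hs hsys hS₂ hSt₂ ht₂
  obtain rfl := h.determinism s hsys K hK hs u₁ u₂ hs₁ hs₂ hS₁ hS₂
  exact ⟨rfl, rfl⟩

theorem Witnesses.not_bad (h : IsWinningStrategy G N' fP fT) (hone : G.OneSystemPlayer)
    {v : GVertex P T} (hK : Witnesses G N' fP fT K v) : ¬ GBad G v := by
  obtain ⟨M, _ | c⟩ := v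
  · exact id
  obtain ⟨hreach, rfl : K.map fP = M, hcom⟩ := hK
  obtain ⟨s, hs, hsys, rfl⟩ := hcom c rfl
  rintro (hbad | ⟨t₁, ht₁, t₂, ht₂, hne, he₁, he₂⟩ | ⟨t, ht, he, p, hpos, hlt⟩ | ⟨hex, hall⟩)
  · exact h.safety K hreach hbad
  · obtain ⟨S₁, hS₁, hSt₁⟩ := Multiset.exists_le_map_eq_s1 he₁
    obtain ⟨S₂, hS₂, hSt₂⟩ := Multiset.exists_le_map_eq_s1 he₂
    exact hne (h.committed_unique hone hreach hs hsys hS₁ hS₂ hSt₁ hSt₂ ht₁ ht₂).1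
  · obtain ⟨S, hS, hSt⟩ := Multiset.exists_le_map_eq_s1 he
    obtain ⟨F, hF⟩ := h.bp.occ.exists_isConfiguration hreach
    obtain ⟨R, rfl⟩ := Multiset.le_iff_exists_add.1 hS
    rw [← hSt] at hpos hlt
    rw [Multiset.map_add, Multiset.count_add] at hlt
    obtain ⟨a, ha, rfl⟩ := Multiset.mem_map.1 (Multiset.count_pos.1 hpos)
    obtain ⟨b, hb, hba⟩ := Multiset.mem_map.1 (Multiset.count_pos.1 (show
      0 < (R.map fP).count (fP a) by omega))
    obtain ⟨S, rfl⟩ := Multiset.exists_cons_of_mem ha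
    obtain ⟨R, rfl⟩ := Multiset.exists_cons_of_mem hb
    have hS' : b ::ₘ S ≤ a ::ₘ S + b ::ₘ R := by
      rw [Multiset.cons_add, Multiset.add_cons]
      exact (Multiset.cons_le_cons b (Multiset.le_add_right S R)).trans
        (Multiset.le_cons_self _ a)
    have heq := (h.committed_unique hone hreach hs hsys hS hS' hSt
      (by rw [← hSt, Multiset.map_cons, Multiset.map_cons, hba]) ht ht).2
    obtain rfl : a = b := (Multiset.cons_inj_left S).1 heq
    exact Multiset.disjoint_left.1 (Multiset.nodup_add.1 hF.nodup).2.2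
      (Multiset.mem_cons_self a S) (Multiset.mem_cons_self a R)
  · obtain ⟨t', ht'⟩ := h.deadlock_avoidance K hreach hex
    obtain ⟨⟨p, hp, hpsys⟩, hnot⟩ := hall _ (h.bp.enabled_map ht')
    rw [← h.bp.map_pre] at hp
    obtain ⟨s', hs', rfl⟩ := Multiset.mem_map.1 hp
    obtain rfl := eq_of_isSystem hone (h.bp.reachable_map_s1 hreach) hs
      (Multiset.mem_of_le ht' hs') hsys hpsys
    exact hnot ⟨t', hs', rfl⟩

end Witnesses

end PetriGame

/-- Player 0 wins as soon as she can maintain an invariant that excludes bad vertices. -/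
theorem WinningP0.of_invariant {V : Type} {edge : V → V → Prop} {isP0 bad : V → Prop} {init : V}
    (Inv : V → Prop) (hinit : Inv init)
    (h₀ : ∀ v, Inv v → isP0 v → ∃ w, edge v w ∧ Inv w)
    (h₁ : ∀ v w, Inv v → ¬ isP0 v → edge v w → Inv w)
    (hbad : ∀ v, Inv v → ¬ bad v) : WinningP0 edge isP0 bad init := by
  have hmove : ∀ v, ∃ w, Inv v → isP0 v → edge v w ∧ Inv w := by
    intro v
    by_cases hv : Inv v ∧ isP0 v
    · obtain ⟨w, hw⟩ := h₀ v hv.1 hv.2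
      exact ⟨w, fun _ _ => hw⟩
    · exact ⟨v, fun h h' => absurd ⟨h, h'⟩ hv⟩
  choose f hf using hmove
  let σ : List V → V := fun l => f (l.headD init)
  have hInv : ∀ l, ConsistentPlay edge isP0 σ init l → ∀ v ∈ l, Inv v := by
    intro l hl
    induction hl with
    | base => simpa using hinit
    | @stepP0 h v _ hv _ ih =>
      exact List.forall_mem_cons.2 ⟨(hf v (ih v List.mem_cons_self) hv).2, ih⟩
    | @stepP1 h v w _ hv hvw ih =>
      exact List.forall_mem_cons.2 ⟨h₁ v w (ih v List.mem_cons_self) hv hvw, ih⟩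
  exact ⟨σ, fun h v hl hv => (hf v (hInv _ hl v List.mem_cons_self) hv).1,
    fun l v hl hv => hbad v (hInv l hl v hv)⟩

/-- If a bounded Petri game with one system player has a winning,
deadlock-avoiding strategy, then Player 0 has a winning strategy in the graph
game `Graph(G)`. -/
theorem petriGame_to_graphGame {P T : Type} [DecidableEq P] [Finite P] [Finite T]
    (G : PetriGame P T) (hbounded : G.Bounded) (hone : G.OneSystemPlayer)
    (h : G.HasWinningStrategy) :
    G.HasWinningGraphStrategy := by
  obtain ⟨P', T', _, N', fP, fT, h⟩ := h
  refine WinningP0.of_invariant (fun v => ∃ K, G.Witnesses N' fP fT K v)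
    ⟨N'.init, Relation.ReflTransGen.refl, h.bp.map_init, fun c hc => by cases hc⟩ ?_ ?_ ?_
  · rintro v ⟨K, hK⟩ hv
    obtain ⟨w, hvw, hw⟩ := hK.exists_edge h hone hv
    exact ⟨w, hvw, K, hw⟩
  · rintro v w ⟨K, hK⟩ hv hvw
    exact hK.exists_of_edge h hone hv hvw
  · rintro v ⟨K, hK⟩
    exact hK.not_bad h hone
end

section
/- Let G be a bounded Petri game with one system player. If Player 0 has a winning strategy in the graph game Graph(G), then Player 0 has a winning strategy in the graph game Graph'(G). -/
/-- The vertex of `Graph(G)` obtained by forgetting the responsibility multiset. -/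
def GVertex'.forget {P T : Type} (v : GVertex' P T) : GVertex P T := (v.1, v.2.1)

namespace PetriGame

variable {P T : Type} [DecidableEq P] {G : PetriGame P T}

/-- The marking of `v` is reachable and, at Player-0 vertices, the responsibility
multiset consists of the system place of the marking. -/
def WellFormed (G : PetriGame P T) (v : GVertex' P T) : Prop :=
  G.net.Reachable v.1 ∧
    (v.2.1 = none → ∃ s, G.isSystem s ∧ s ∈ v.1 ∧ v.2.2 = {s})

/-- The strategy for `Graph'(G)` that plays as `σ` does on the projected history,
leaving the responsibility multiset unchanged. -/
def liftStrategy (σ : List (GVertex P T) → GVertex P T) (l : List (GVertex' P T)) :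
    GVertex' P T :=
  ((σ (l.map GVertex'.forget)).1, (σ (l.map GVertex'.forget)).2, (l.head?.map (·.2.2)).getD 0)

end PetriGame

section

open PetriGame

variable {P T : Type} [DecidableEq P] {G : PetriGame P T}

theorem GEdge'.forget {v w : GVertex' P T} (h : GEdge' G v w) :
    GEdge G v.forget w.forget := by
  cases h with
  | e1 hs hm hc => exact .e1 hs hm hc
  | e2 ht hf _ => exact .e2 ht hf
  | e3 ht hc hf _ _ _ => exact .e3 ht hc hf

theorem GEdge'.wellFormed {v w : GVertex' P T} (h : GEdge' G v w) (hv : G.WellFormed v) :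
    G.WellFormed w := by
  cases h with
  | e1 _ _ _ => exact ⟨hv.1, nofun⟩
  | e2 _ hf _ => exact ⟨hv.1.tail ⟨_, hf⟩, nofun⟩
  | e3 _ _ hf _ hs hm => exact ⟨hv.1.tail ⟨_, hf⟩, fun _ => ⟨_, hs, hm, rfl⟩⟩

theorem ConsistentPlay.forget {σ : List (GVertex P T) → GVertex P T} {init : GVertex' P T}
    {l : List (GVertex' P T)}
    (h : ConsistentPlay (GEdge' G) (fun v => v.2.1 = none) (liftStrategy σ) init l) :
    ConsistentPlay (GEdge G) (fun v => v.2 = none) σ init.forget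
      (l.map GVertex'.forget) := by
  induction h with
  | base => exact .base
  | stepP0 _ h0 he ih => exact .stepP0 ih h0 he.forget
  | stepP1 _ h0 he ih => exact .stepP1 ih h0 he.forget

theorem ConsistentPlay.wellFormed {isP0 : GVertex' P T → Prop}
    {σ : List (GVertex' P T) → GVertex' P T} {init : GVertex' P T} {l : List (GVertex' P T)}
    (h : ConsistentPlay (GEdge' G) isP0 σ init l) (hinit : G.WellFormed init) :
    ∀ v ∈ l, G.WellFormed v := by
  induction h with
  | base => simpa using hinit
  | stepP0 _ _ he ih =>
    exact List.forall_mem_cons.2 ⟨he.wellFormed (ih _ List.mem_cons_self), ih⟩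
  | stepP1 _ _ he ih =>
    exact List.forall_mem_cons.2 ⟨he.wellFormed (ih _ List.mem_cons_self), ih⟩

/-- With one system player, Player-0 moves of `Graph(G)` lift to `Graph'(G)`. -/
theorem GEdge.lift (hone : G.OneSystemPlayer) {v : GVertex' P T} {w : GVertex P T}
    (hv : G.WellFormed v) (h0 : v.2.1 = none) (h : GEdge G v.forget w) :
    GEdge' G v (w.1, w.2, v.2.2) := by
  obtain ⟨M, o, R⟩ := v
  obtain ⟨hr, hR⟩ := hv
  obtain ⟨s, hs, hm, rfl⟩ : ∃ s, G.isSystem s ∧ s ∈ M ∧ R = {s} := hR h0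
  obtain rfl : o = none := h0
  cases h with
  | e1 hs' hm' hc =>
    obtain ⟨_, _, _, huniq⟩ := hone M hr
    obtain rfl := (huniq _ hs' hm').trans (huniq _ hs hm).symm
    exact .e1 hs' hm' hc

end

/-- If Player 0 has a winning strategy in the graph game `Graph(G)` of a
bounded Petri game with one system player, then Player 0 has a winning
strategy in the refined graph game `Graph'(G)`. -/
theorem graphGame_to_graphGame' {P T : Type} [DecidableEq P] [Finite P] [Finite T]
    (G : PetriGame P T) (hbounded : G.Bounded) (hone : G.OneSystemPlayer)
    (h : G.HasWinningGraphStrategy) :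
    G.HasWinningGraphStrategy' := by
  obtain ⟨σ, hσ, hwin⟩ := h
  obtain ⟨s₀, hs₀, hcount, -⟩ := hone _ .refl
  have hmem : s₀ ∈ G.net.init := Multiset.count_pos.1 (hcount ▸ Nat.one_pos)
  have hinit : G.WellFormed (G.net.init, none, ({s₀} : Multiset P)) :=
    ⟨.refl, fun _ => ⟨s₀, hs₀, hmem, rfl⟩⟩
  refine ⟨s₀, hs₀, hmem, PetriGame.liftStrategy σ, fun h v hp h0 => ?_, fun l v hp hv => ?_⟩
  · exact GEdge.lift hone (hp.wellFormed hinit v List.mem_cons_self) h0 (hσ _ _ hp.forget h0)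
  · exact hwin _ _ hp.forget (List.mem_map_of_mem hv)
end
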